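/- arXiv:2208.13238 — 3 statements merged into one kernel-verified Lean document; each statement's English description precedes it below -/
import Mathlib

section
/- Let k ≥ 2 be an integer and 0 ≤ α < 1/2. Then for every integer j ≥ 0, ∫₀^∞ x^{(k+2α−1)/k} S(x)² (log x)^j dx = (−1)^{j+1}/(4π²) · χ^{(j)}(1 + (1−2α)/k), where S(x) = sin(πx)/(πx) and χ(s) = 2^s π^{s−1} Γ(1−s) sin(πs/2). -/
open Real MeasureTheory

/-- The normalized sinc function `S(x) = sin(πx)/(πx)`, with `S(0) = 1`. -/
noncomputable def sincS (x : ℝ) : ℝ := if x = 0 then 1 else Real.sin (π * x) / (π * x)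

/-- `χ(s) = 2^s π^{s−1} Γ(1−s) sin(πs/2)`, the factor in the functional equation of `ζ`. -/
noncomputable def chiFE (s : ℂ) : ℂ :=
  (2 : ℂ) ^ s * (π : ℂ) ^ (s - 1) * Complex.Gamma (1 - s) * Complex.sin (π * s / 2)

theorem mellin_laplace (f L : ℝ → ℝ) (hf : Measurable f) (hf0 : ∀ u, 0 ≤ f u)
    (hi : ∀ t : ℝ, 0 < t → IntegrableOn (fun u => f u * Real.exp (-(t * u))) (Set.Ioi 0))
    (hL : ∀ t : ℝ, 0 < t → ∫ u in Set.Ioi (0:ℝ), f u * Real.exp (-(t * u)) = L t)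
    (a : ℂ) (ha : 0 < a.re) (hc : MellinConvergent (fun t => (L t : ℂ)) a) :
    mellin (fun u => (f u : ℂ)) (1 - a) * Complex.Gamma a = mellin (fun t => (L t : ℂ)) a := by
  set F : ℝ → ℝ → ℂ := fun t u => (t : ℂ) ^ (a - 1) * ((f u * Real.exp (-(t * u)) : ℝ) : ℂ) with hF
  have hmeas : Measurable (Function.uncurry F) := by
    simp only [hF, Function.uncurry_def]
    fun_prop
  have hint : Integrable (Function.uncurry F)
      ((volume.restrict (Set.Ioi (0:ℝ))).prod (volume.restrict (Set.Ioi (0:ℝ)))) := by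
    rw [integrable_prod_iff hmeas.aestronglyMeasurable]
    constructor
    · refine (ae_restrict_iff' measurableSet_Ioi).2 (Filter.Eventually.of_forall fun t ht => ?_)
      have h0 : Integrable (fun u => ((f u * Real.exp (-(t * u)) : ℝ) : ℂ))
          (volume.restrict (Set.Ioi (0:ℝ))) := Integrable.ofReal (𝕜 := ℂ) (hi t ht)
      exact h0.const_mul ((t : ℂ) ^ (a - 1))
    · have := hc.norm
      refine (integrableOn_congr_fun (fun t ht => ?_) measurableSet_Ioi).1 this
      have h1 : ∀ u, ‖Function.uncurry F (t, u)‖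
          = ‖(t : ℂ) ^ (a - 1)‖ * (f u * Real.exp (-(t * u))) := by
        intro u
        simp only [hF, Function.uncurry, norm_mul, Complex.norm_real]
        rw [Real.norm_of_nonneg (hf0 u), Real.norm_of_nonneg (Real.exp_pos _).le]
      simp only [h1]
      rw [integral_const_mul, hL t ht, smul_eq_mul, norm_mul, Complex.norm_real,
        Real.norm_of_nonneg]
      rw [← hL t ht]
      exact integral_nonneg fun u => mul_nonneg (hf0 u) (Real.exp_pos _).le
  have hsw := integral_integral_swap hint
  have hleft : ∫ t in Set.Ioi (0:ℝ), ∫ u in Set.Ioi (0:ℝ), F t u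
      = mellin (fun t => (L t : ℂ)) a := by
    refine setIntegral_congr_fun measurableSet_Ioi fun t ht => ?_
    simp only [hF, smul_eq_mul]
    rw [integral_const_mul, integral_complex_ofReal, hL t ht]
  have hright : ∫ u in Set.Ioi (0:ℝ), ∫ t in Set.Ioi (0:ℝ), F t u
      = mellin (fun u => (f u : ℂ)) (1 - a) * Complex.Gamma a := by
    rw [mellin, ← integral_mul_const]
    refine setIntegral_congr_fun measurableSet_Ioi fun u hu => ?_
    have := Complex.integral_cpow_mul_exp_neg_mul_Ioi ha hu
    simp only [hF, smul_eq_mul]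
    have h2 : ∀ t : ℝ, (t : ℂ) ^ (a - 1) * ((f u * Real.exp (-(t * u)) : ℝ) : ℂ)
        = f u * ((t : ℂ) ^ (a - 1) * Complex.exp (-(u * t))) := by
      intro t; push_cast; rw [mul_comm (t : ℂ) u]; ring
    simp only [h2]
    rw [integral_const_mul, this, sub_sub_cancel_left, one_div, Complex.inv_cpow, Complex.cpow_neg]
    · ring
    · rw [Complex.arg_ofReal_of_nonneg (le_of_lt hu)]; exact Real.pi_pos.ne
  rw [← hright, ← hleft, hsw]

theorem mellin_inv_one_add_conv (a : ℂ) (ha : 0 < a.re) (ha1 : a.re < 1) :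
    MellinConvergent (fun t => (((1 + t)⁻¹ : ℝ) : ℂ)) a := by
  refine mellinConvergent_of_isBigO_rpow (a := 1) (b := 0) ?_ ?_ ha1 ?_ ha
  · refine ContinuousOn.locallyIntegrableOn ?_ measurableSet_Ioi
    refine Complex.continuous_ofReal.comp_continuousOn ?_
    refine ContinuousOn.inv₀ (by fun_prop) fun t ht => ?_
    have : (0:ℝ) < t := ht
    positivity
  · refine Asymptotics.IsBigO.of_bound 1 ?_
    filter_upwards [Filter.eventually_gt_atTop 0] with t ht
    rw [Complex.norm_real, Real.rpow_neg_one, one_mul, Real.norm_of_nonneg (by positivity),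
      Real.norm_of_nonneg (by positivity)]
    gcongr
    linarith
  · refine Asymptotics.IsBigO.of_bound 1 ?_
    filter_upwards [self_mem_nhdsWithin] with t ht
    have ht : (0:ℝ) < t := ht
    rw [Complex.norm_real, Real.norm_of_nonneg (by positivity)]
    simp only [neg_zero, Real.rpow_zero, norm_one, mul_one]
    exact inv_le_one_of_one_le₀ (by linarith)

theorem mellin_inv_one_add (a : ℂ) (ha : 0 < a.re) (ha1 : a.re < 1) :
    mellin (fun t => (((1 + t)⁻¹ : ℝ) : ℂ)) a = Complex.Gamma (1 - a) * Complex.Gamma a := by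
  have hexp : ∀ t u : ℝ, Real.exp (-u) * Real.exp (-(t * u)) = Real.exp (-(1 + t) * u) := by
    intro t u; rw [← Real.exp_add]; ring_nf
  rw [← mellin_laplace (fun u => Real.exp (-u)) _ (by fun_prop) (fun u => (Real.exp_pos _).le)
    ?_ ?_ a ha (mellin_inv_one_add_conv a ha ha1)]
  · rw [Complex.Gamma_eq_integral (s := 1 - a) (by simpa using ha1),
      Complex.GammaIntegral_eq_mellin]
  · intro t ht
    simp only [hexp]
    exact integrableOn_exp_mul_Ioi (by linarith) 0
  · intro t ht
    simp only [hexp]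
    rw [integral_exp_mul_Ioi (by linarith)]
    rw [mul_zero, Real.exp_zero, neg_div_neg_eq, one_div]

theorem laplace_one_sub_cos (t : ℝ) (ht : 0 < t) :
    IntegrableOn (fun u => (1 - Real.cos u) * Real.exp (-(t * u))) (Set.Ioi 0) ∧
    ∫ u in Set.Ioi (0:ℝ), (1 - Real.cos u) * Real.exp (-(t * u)) = t⁻¹ * (1 + t ^ (2:ℝ))⁻¹ := by
  have key : ∀ u : ℝ, (1 - Real.cos u) * Real.exp (-(t * u)) =
      Real.exp (-t * u) - (Complex.exp ((-t + Complex.I) * u)).re := by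
    intro u
    rw [Complex.exp_re]
    simp
    ring
  have hre : ((-t : ℂ) + Complex.I).re < 0 := by simpa using ht
  have i1 := integrableOn_exp_mul_Ioi (a := -t) (by linarith) 0
  have i2 := integrableOn_exp_mul_complex_Ioi hre 0
  simp only [key]
  have i3 : IntegrableOn (fun u : ℝ => (Complex.exp ((-t + Complex.I) * u)).re) (Set.Ioi 0) :=
    i2.re
  refine ⟨i1.sub i3, ?_⟩
  rw [integral_sub i1 i3, integral_exp_mul_Ioi (by linarith)]
  have := integral_re i2
  simp only [RCLike.re_to_complex] at this
  rw [this, integral_exp_mul_complex_Ioi hre]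
  simp [Complex.div_re, Complex.normSq_apply]
  have : t * t + 1 ≠ 0 := by positivity
  have : 1 + t ^ 2 ≠ 0 := by positivity
  field_simp
  ring

theorem mellin_one_sub_cos (s : ℂ) (h1 : 1 < s.re) (h2 : s.re < 2) :
    mellin (fun u => ((1 - Real.cos u : ℝ) : ℂ)) (1 - s)
      = - (Complex.Gamma (1 - s) * Complex.sin (π * s / 2)) := by
  have hre : ((s - 1) / ((2:ℝ):ℂ)).re = (s.re - 1) / 2 := by
    rw [Complex.div_ofReal_re]; simp
  have hb0 : 0 < ((s - 1) / ((2:ℝ):ℂ)).re := by rw [hre]; linarith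
  have hb1 : ((s - 1) / ((2:ℝ):ℂ)).re < 1 := by rw [hre]; linarith
  have hcong : ∀ t ∈ Set.Ioi (0:ℝ), (t : ℂ) ^ (s - 1) • ((t⁻¹ * (1 + t ^ (2:ℝ))⁻¹ : ℝ) : ℂ)
      = (t : ℂ) ^ (s - 1 - 1) • (((1 + t ^ (2:ℝ))⁻¹ : ℝ) : ℂ) := by
    intro t ht
    have ht : (0:ℝ) < t := ht
    have ht0 : (t : ℂ) ≠ 0 := by exact_mod_cast ht.ne'
    rw [Complex.cpow_sub (s - 1) 1 ht0, Complex.cpow_one]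
    push_cast
    simp only [smul_eq_mul]
    ring
  have hconv : MellinConvergent (fun t : ℝ => ((t⁻¹ * (1 + t ^ (2:ℝ))⁻¹ : ℝ) : ℂ)) s := by
    have := (MellinConvergent.comp_rpow (s := s - 1) (a := 2) two_ne_zero).2
      (mellin_inv_one_add_conv _ hb0 hb1)
    exact (integrableOn_congr_fun hcong measurableSet_Ioi).2 this
  have hm : mellin (fun t : ℝ => ((t⁻¹ * (1 + t ^ (2:ℝ))⁻¹ : ℝ) : ℂ)) s
      = 1 / 2 * (Complex.Gamma (1 - (s - 1) / 2) * Complex.Gamma ((s - 1) / 2)) := by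
    have e1 := mellin_comp_rpow (fun t => (((1 + t)⁻¹ : ℝ) : ℂ)) (s - 1) 2
    rw [mellin_inv_one_add _ hb0 hb1] at e1
    have e2 : mellin (fun t : ℝ => ((t⁻¹ * (1 + t ^ (2:ℝ))⁻¹ : ℝ) : ℂ)) s
      = mellin (fun t : ℝ => (((1 + t ^ (2:ℝ))⁻¹ : ℝ) : ℂ)) (s - 1) :=
      setIntegral_congr_fun measurableSet_Ioi hcong
    rw [e2, e1]
    simp
  have hP := mellin_laplace (fun u => 1 - Real.cos u) (fun t => t⁻¹ * (1 + t ^ (2:ℝ))⁻¹)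
    (by fun_prop) (fun u => by linarith [Real.cos_le_one u])
    (fun t ht => (laplace_one_sub_cos t ht).1) (fun t ht => (laplace_one_sub_cos t ht).2)
    s (by linarith) hconv
  rw [hm, mul_comm (Complex.Gamma (1 - (s-1)/2)), Complex.Gamma_mul_Gamma_one_sub] at hP
  have hG := Complex.Gamma_mul_Gamma_one_sub s
  have hG0 : Complex.Gamma s ≠ 0 := Complex.Gamma_ne_zero_of_re_pos (by linarith)
  have hsinne : Complex.sin (π * s) ≠ 0 := by
    rw [Complex.sin_ne_zero_iff]
    intro n hn
    have hpi : (π : ℂ) ≠ 0 := by exact_mod_cast Real.pi_ne_zero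
    have hsn : s = n := by
      rw [mul_comm (n : ℂ)] at hn
      exact mul_left_cancel₀ hpi hn
    rw [hsn] at h1 h2
    simp at h1 h2
    have a1 : (1:ℤ) < n := by exact_mod_cast h1
    have a2 : n < (2:ℤ) := by exact_mod_cast h2
    omega
  have hdouble : Complex.sin (π * s)
      = 2 * Complex.sin (π * s / 2) * Complex.cos (π * s / 2) := by
    rw [← Complex.sin_two_mul]; ring_nf
  have hsc : Complex.sin (π * ((s - 1) / 2)) = - Complex.cos (π * s / 2) := by
    rw [← Complex.sin_sub_pi_div_two]; ring_nf
  rw [hdouble] at hsinne hG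
  have hs0 : Complex.sin (π * s / 2) ≠ 0 := fun h => hsinne (by rw [h]; ring)
  have hc0 : Complex.cos (π * s / 2) ≠ 0 := fun h => hsinne (by rw [h]; ring)
  rw [hsc] at hP
  apply mul_right_cancel₀ hG0
  rw [hP]
  have : -(Complex.Gamma (1 - s) * Complex.sin (π * s / 2)) * Complex.Gamma s
    = - (Complex.Gamma s * Complex.Gamma (1 - s)) * Complex.sin (π * s / 2) := by ring
  rw [this, hG]
  field_simp

noncomputable def gS (x : ℝ) : ℂ := ((Real.sin (π * x) ^ 2 : ℝ) : ℂ)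

theorem chi_eq (s : ℂ) (h1 : 1 < s.re) (h2 : s.re < 2) :
    chiFE s = -4 * mellin gS (1 - s) := by
  have e : gS = fun x => (1/2 : ℂ) • ((1 - Real.cos ((2 * π) * x) : ℝ) : ℂ) := by
    ext x
    rw [gS, Real.sin_sq_eq_half_sub, smul_eq_mul, ← mul_assoc]
    push_cast
    ring
  have hpi : (π : ℂ) ≠ 0 := by exact_mod_cast Real.pi_ne_zero
  rw [e, mellin_const_smul, mellin_comp_mul_left (fun x => ((1 - Real.cos x : ℝ) : ℂ)) _
    (by positivity : 0 < 2 * π), mellin_one_sub_cos s h1 h2, chiFE, neg_sub, Complex.ofReal_mul,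
    Complex.mul_cpow_ofReal_nonneg (by norm_num) Real.pi_pos.le]
  simp only [smul_eq_mul, Complex.ofReal_ofNat]
  rw [Complex.cpow_sub s 1 two_ne_zero, Complex.cpow_one]
  ring

theorem gS_top (j : ℕ) : ∀ a : ℝ, a < 0 →
    (fun t : ℝ => (Real.log t ^ j) • gS t) =O[Filter.atTop] (fun t : ℝ => t ^ (-a)) := by
  induction j with
  | zero =>
    intro a ha
    refine Asymptotics.IsBigO.of_bound 1 ?_
    filter_upwards [Filter.eventually_ge_atTop 1] with t ht
    have h1 : (1:ℝ) ≤ t ^ (-a) := Real.one_le_rpow ht (by linarith)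
    rw [pow_zero, one_smul, gS, Complex.norm_real, Real.norm_of_nonneg (by positivity),
      Real.norm_of_nonneg (by linarith), one_mul]
    exact (Real.sin_sq_le_one _).trans h1
  | succ j ih =>
    intro a ha
    have := isBigO_rpow_top_log_smul (by linarith : a < a / 2) (ih (a / 2) (by linarith))
    refine this.congr_left fun t => ?_
    rw [smul_smul, pow_succ']

theorem gS_bot (j : ℕ) : ∀ b : ℝ, -2 < b →
    (fun t : ℝ => (Real.log t ^ j) • gS t) =O[nhdsWithin 0 (Set.Ioi 0)]
      (fun t : ℝ => t ^ (-b)) := by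
  induction j with
  | zero =>
    intro b hb
    refine Asymptotics.IsBigO.of_bound (π ^ 2) ?_
    filter_upwards [Ioc_mem_nhdsGT (zero_lt_one' ℝ)] with t ht
    rw [pow_zero, one_smul, gS, Complex.norm_real, Real.norm_of_nonneg (by positivity),
      Real.norm_of_nonneg (Real.rpow_nonneg ht.1.le _)]
    have h1 : Real.sin (π * t) ^ 2 ≤ (π * t) ^ 2 := Real.sin_sq_le_sq
    have h2 : t ^ (2:ℝ) ≤ t ^ (-b) :=
      Real.rpow_le_rpow_of_exponent_ge ht.1 ht.2 (by linarith)
    rw [Real.rpow_two] at h2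
    rw [mul_pow] at h1
    nlinarith [Real.pi_pos, sq_nonneg π]
  | succ j ih =>
    intro b hb
    have := isBigO_rpow_zero_log_smul (by linarith : (b - 2) / 2 < b)
      (ih ((b - 2) / 2) (by linarith))
    refine this.congr_left fun t => ?_
    rw [smul_smul, pow_succ']

theorem gS_deriv (j : ℕ) (z : ℂ) (h1 : -2 < z.re) (h2 : z.re < 0) :
    HasDerivAt (mellin (fun t : ℝ => (Real.log t ^ j) • gS t))
      (mellin (fun t : ℝ => (Real.log t ^ (j + 1)) • gS t) z) z := by
  have hc : LocallyIntegrableOn (fun t : ℝ => (Real.log t ^ j) • gS t) (Set.Ioi 0) := by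
    refine ContinuousOn.locallyIntegrableOn ?_ measurableSet_Ioi
    have c1 : ContinuousOn (fun t : ℝ => Real.log t ^ j) (Set.Ioi 0) :=
      (Real.continuousOn_log.mono fun t ht => ne_of_gt ht).pow j
    have c2 : ContinuousOn gS (Set.Ioi 0) := by unfold gS; fun_prop
    exact c1.smul c2
  have := (mellin_hasDerivAt_of_isBigO_rpow (s := z) hc (gS_top j (z.re / 2) (by linarith)) (by linarith)
    (gS_bot j ((z.re - 2) / 2) (by linarith)) (by linarith)).2
  have e : (fun t : ℝ => Real.log t ^ (j + 1) • gS t)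
      = fun t : ℝ => Real.log t • Real.log t ^ j • gS t := by
    ext t
    rw [smul_smul, pow_succ']
  rw [e]
  exact this

theorem chi_iter (j : ℕ) : ∀ (s : ℂ), 1 < s.re → s.re < 2 →
    iteratedDeriv j chiFE s
      = -4 * (-1) ^ j * mellin (fun t : ℝ => (Real.log t ^ j) • gS t) (1 - s) := by
  induction j with
  | zero => intro s h1 h2; simp [chi_eq s h1 h2]
  | succ j ih =>
    intro s h1 h2
    rw [iteratedDeriv_succ]
    have hev : iteratedDeriv j chiFE =ᶠ[nhds s] fun s =>
        -4 * (-1) ^ j * mellin (fun t : ℝ => (Real.log t ^ j) • gS t) (1 - s) := by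
      have o1 : ∀ᶠ w : ℂ in nhds s, 1 < w.re :=
        (isOpen_lt continuous_const Complex.continuous_re).mem_nhds h1
      have o2 : ∀ᶠ w : ℂ in nhds s, w.re < 2 :=
        (isOpen_lt Complex.continuous_re continuous_const).mem_nhds h2
      filter_upwards [o1, o2] with w hw1 hw2 using ih w hw1 hw2
    rw [hev.deriv_eq]
    have hd := gS_deriv j (1 - s) (by simp; linarith) (by simp; linarith)
    have h3 : HasDerivAt (fun w : ℂ => 1 - w) (-1) s := (hasDerivAt_id s).const_sub 1
    have := ((hd.comp s h3).const_mul (-4 * (-1 : ℂ) ^ j)).deriv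
    simp only [Function.comp_def] at this
    rw [this]
    ring

/-- For `k ≥ 2`, `0 ≤ α < 1/2` and `j ≥ 0`,
`∫₀^∞ x^{(k+2α−1)/k} S(x)² (log x)^j dx = ((−1)^{j+1}/(4π²)) χ^{(j)}(1 + (1−2α)/k)`. -/
theorem integral_sinc_sq_log_pow (k : ℕ) (hk : 2 ≤ k) (α : ℝ) (hα0 : 0 ≤ α)
    (hα : α < 1 / 2) (j : ℕ) :
    ((∫ x : ℝ in Set.Ioi (0 : ℝ),
        x ^ (((k : ℝ) + 2 * α - 1) / k) * (sincS x) ^ 2 * (Real.log x) ^ j : ℝ) : ℂ)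
      = (-1) ^ (j + 1) / (4 * (π : ℂ) ^ 2) *
          iteratedDeriv j chiFE (((1 + (1 - 2 * α) / k : ℝ) : ℂ)) := by
  have hk0 : (2:ℝ) ≤ k := by exact_mod_cast hk
  have hkpos : (0:ℝ) < k := by linarith
  set β : ℝ := (1 - 2 * α) / k with hβ
  have hβ0 : 0 < β := div_pos (by linarith) hkpos
  have hβ1 : β < 1 := by rw [hβ, div_lt_one hkpos]; linarith
  have hexp : ((k : ℝ) + 2 * α - 1) / k = 1 - β := by rw [hβ]; field_simp; ring
  have hpi : (π : ℂ) ≠ 0 := by exact_mod_cast Real.pi_ne_zero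
  rw [chi_iter j _ (by rw [Complex.ofReal_re]; linarith) (by rw [Complex.ofReal_re]; linarith),
    hexp]
  have hm : mellin (fun t : ℝ => (Real.log t ^ j) • gS t) (1 - ((1 + β : ℝ) : ℂ))
      = π ^ 2 * ((∫ x : ℝ in Set.Ioi (0 : ℝ),
        x ^ (1 - β) * (sincS x) ^ 2 * (Real.log x) ^ j : ℝ) : ℂ) := by
    rw [← integral_complex_ofReal, ← integral_const_mul, mellin]
    refine setIntegral_congr_fun measurableSet_Ioi fun t ht => ?_
    have ht : (0:ℝ) < t := ht
    have e1 : (1 - ((1 + β : ℝ) : ℂ) - 1) = ((1 - β - 2 : ℝ) : ℂ) := by push_cast; ring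
    have ht0 : (t : ℂ) ≠ 0 := by exact_mod_cast ht.ne'
    simp only [e1, ← Complex.ofReal_cpow ht.le]
    rw [Real.rpow_sub ht, Real.rpow_two, sincS, if_neg ht.ne', gS, smul_eq_mul, Complex.real_smul]
    simp only [Complex.ofReal_mul, Complex.ofReal_pow, Complex.ofReal_div]
    push_cast
    field_simp
  rw [hm, pow_succ]
  have : ((-1 : ℂ) ^ j) * (-1) ^ j = 1 := by rw [← mul_pow]; simp
  field_simp
  linear_combination (-(((∫ x : ℝ in Set.Ioi (0 : ℝ),
        x ^ (1 - β) * (sincS x) ^ 2 * (Real.log x) ^ j : ℝ) : ℂ))) * this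
end

section
/- Let k ≥ 2, 0 ≤ α < 1/2, and let h be an arithmetic function with |h(d)| ≤ C·d^{−α+ε₁} for a sufficiently small ε₁ > 0. Then for H ≥ 2 and any ε' ∈ (0,1), ∑_{d₁,d₂ ≥ 1} |h(d₁)h(d₂)|/(d₁^k d₂^k) · ∑_{λ≥1} ((d₁,d₂)^{2k}/λ²) · 𝟙[Hλ/(d₁,d₂)^k ≥ H^{ε'}] ≪ H^{(1−ε')(1−2α+2ε₁)/k − 2}·H², i.e. the left-hand side is O(H^{(1−ε')(1−2α+2ε₁)/k}) after multiplying by 2H². -/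
lemma pnat_tsum_bound (f : ℕ → ℝ) (B : ℝ) (hf : ∀ n : ℕ, 1 ≤ n → 0 ≤ f n)
    (hB : ∀ N : ℕ, ∑ n ∈ Finset.Icc 1 N, f n ≤ B) :
    Summable (fun n : ℕ+ => f n) ∧ ∑' n : ℕ+, f n ≤ B := by
  have key : ∀ s : Finset ℕ+, ∑ n ∈ s, f (n : ℕ) ≤ B := by
    intro s
    have h1 : ∑ n ∈ s, f (n : ℕ) = ∑ n ∈ s.map ⟨fun n : ℕ+ => (n : ℕ), PNat.coe_injective⟩, f n := by
      rw [Finset.sum_map]; rfl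
    rw [h1]
    refine le_trans (Finset.sum_le_sum_of_subset_of_nonneg (t := Finset.Icc 1 (s.sup (fun n : ℕ+ => (n : ℕ)))) ?_ ?_) (hB _)
    · intro x hx
      simp only [Finset.mem_map, Function.Embedding.coeFn_mk] at hx
      obtain ⟨a, ha, rfl⟩ := hx
      exact Finset.mem_Icc.2 ⟨a.pos, Finset.le_sup (f := fun n : ℕ+ => (n : ℕ)) ha⟩
    · intro i hi _
      exact hf i (Finset.mem_Icc.1 hi).1
  have hnn : ∀ n : ℕ+, 0 ≤ f (n : ℕ) := fun n => hf n n.pos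
  have hs : Summable (fun n : ℕ+ => f n) := summable_of_sum_le hnn key
  exact ⟨hs, hs.tsum_le_of_sum_le key⟩

lemma low_sum (u Y : ℝ) (hu : -1 < u) (hu0 : u ≤ 0) (hY : 1 ≤ Y) (N : ℕ) :
    ∑ n ∈ Finset.Icc 1 N, (if (n : ℝ) ≤ Y then (n : ℝ) ^ u else 0)
      ≤ (min (N : ℝ) Y) ^ (1 + u) / (1 + u) := by
  have h1u : 0 < 1 + u := by linarith
  induction N with
  | zero =>
    have : min ((0 : ℕ) : ℝ) Y = 0 := by simp; linarith
    rw [this, Real.zero_rpow h1u.ne']; simp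
  | succ N ih =>
    rw [Finset.sum_Icc_succ_top (by omega)]
    by_cases hc : ((N + 1 : ℕ) : ℝ) ≤ Y
    · rw [if_pos hc, min_eq_left hc]
      have hc' : (N : ℝ) ≤ Y := by push_cast at hc; linarith
      rw [min_eq_left hc'] at ih
      set g : ℝ := ((N + 1 : ℕ) : ℝ) with hg
      have hgN : (N : ℝ) = g - 1 := by rw [hg]; push_cast; ring
      have hg1 : 1 ≤ g := by rw [hg]; push_cast; linarith [Nat.cast_nonneg (α := ℝ) N]
      have hg0 : 0 < g := by linarith
      have hb : (1 + (-1 / g)) ^ (1 + u) ≤ 1 + (1 + u) * (-1 / g) := by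
        apply rpow_one_add_le_one_add_mul_self _ h1u.le (by linarith)
        rw [le_div_iff₀ hg0]; linarith
      have h3 : (N : ℝ) ^ (1 + u) = g ^ (1 + u) * (1 + (-1 / g)) ^ (1 + u) := by
        rw [← Real.mul_rpow hg0.le]
        · congr 1; rw [hgN]; field_simp; ring
        · have : 1 + -1 / g = (g - 1) / g := by field_simp; ring
          rw [this]; apply div_nonneg <;> linarith
      have h4 : g ^ (1 + u) = g * g ^ u := by rw [Real.rpow_add hg0, Real.rpow_one]
      have h5 : (N : ℝ) ^ (1 + u) ≤ g ^ (1 + u) - (1 + u) * g ^ u := by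
        rw [h3]
        calc _ ≤ g ^ (1 + u) * (1 + (1 + u) * (-1 / g)) := by gcongr
          _ = _ := by rw [h4]; field_simp; ring
      calc _ ≤ (N : ℝ) ^ (1 + u) / (1 + u) + g ^ u := by linarith
        _ ≤ (g ^ (1 + u) - (1 + u) * g ^ u) / (1 + u) + g ^ u := by gcongr
        _ = _ := by field_simp; ring
    · rw [if_neg hc, add_zero]
      refine ih.trans ?_
      have : 0 ≤ min (N : ℝ) Y := le_min (by positivity) (by linarith)
      gcongr
      linarith

lemma step_high (g : ℝ) (hg : 1 ≤ g) :
    g ^ (-(3 / 2) : ℝ) ≤ 5 * (g ^ (-(1 / 2) : ℝ) - (g + 1) ^ (-(1 / 2) : ℝ)) := by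
  have hg0 : 0 < g := by linarith
  have e1 : g ^ (-(3 / 2) : ℝ) = 1 / (g * √g) := by
    rw [Real.rpow_neg hg0.le, show (3 / 2 : ℝ) = 1 + 1 / 2 by norm_num, Real.rpow_add hg0,
      Real.rpow_one, ← Real.sqrt_eq_rpow, one_div]
  have e2 : ∀ x : ℝ, 0 < x → x ^ (-(1 / 2) : ℝ) = 1 / √x := by
    intro x hx
    rw [Real.rpow_neg hx.le, ← Real.sqrt_eq_rpow, one_div]
  rw [e1, e2 g hg0, e2 (g + 1) (by linarith)]
  set a := √g
  set b := √(g + 1)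
  have ha : 0 < a := Real.sqrt_pos.2 hg0
  have hb : 0 < b := Real.sqrt_pos.2 (by linarith)
  have ha2 : a * a = g := Real.mul_self_sqrt hg0.le
  have hb2 : b * b = g + 1 := Real.mul_self_sqrt (by linarith)
  have hab : b ≤ 3 / 2 * a := by nlinarith
  have e3 : 1 / a - 1 / b = 1 / (a * b * (a + b)) := by
    field_simp
    nlinarith
  rw [e3, ← ha2, mul_one_div, div_le_div_iff₀ (by positivity) (by positivity)]
  have : a * b * (a + b) ≤ a * (3 / 2 * a) * (a + 3 / 2 * a) := by gcongr
  nlinarith [mul_pos (mul_pos ha ha) ha]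

lemma high_sum (Y : ℝ) (hY : 1 ≤ Y) (N : ℕ) :
    ∑ n ∈ Finset.Icc 1 N, (if Y < (n : ℝ) then (n : ℝ) ^ (-(3 / 2) : ℝ) else 0)
      ≤ 5 * (Y ^ (-(1 / 2) : ℝ) - (max ((N : ℝ) + 1) Y) ^ (-(1 / 2) : ℝ)) := by
  induction N with
  | zero => simp [max_eq_right hY]
  | succ N ih =>
    rw [Finset.sum_Icc_succ_top (by omega)]
    have hN : (0 : ℝ) ≤ N := by positivity
    push_cast
    by_cases hc : Y < (N : ℝ) + 1
    · rw [if_pos hc]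
      rw [max_eq_left hc.le] at ih
      rw [max_eq_left (by linarith)]
      have := step_high ((N : ℝ) + 1) (by linarith)
      linarith
    · rw [if_neg hc, add_zero]
      refine ih.trans ?_
      have : (max ((N : ℝ) + 1 + 1) Y) ^ (-(1 / 2) : ℝ) ≤ (max ((N : ℝ) + 1) Y) ^ (-(1 / 2) : ℝ) := by
        apply Real.rpow_le_rpow_of_nonpos
        · positivity
        · gcongr; linarith
        · norm_num
      linarith

lemma sq_sum (M : ℝ) (hM : 1 ≤ M) (N : ℕ) :
    ∑ n ∈ Finset.Icc 1 N, (if M ≤ (n : ℝ) then 1 / (n : ℝ) ^ 2 else 0)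
      ≤ 2 * (1 / M - 1 / (max ((N : ℝ) + 1) M)) := by
  induction N with
  | zero => simp [max_eq_right hM]
  | succ N ih =>
    rw [Finset.sum_Icc_succ_top (by omega)]
    have hN : (0 : ℝ) ≤ N := by positivity
    push_cast
    by_cases hc : M ≤ (N : ℝ) + 1
    · rw [if_pos hc]
      rw [max_eq_left hc] at ih
      rw [max_eq_left (by linarith)]
      have : 1 / ((N : ℝ) + 1) ^ 2 ≤ 2 * (1 / ((N : ℝ) + 1) - 1 / ((N : ℝ) + 1 + 1)) := by
        rw [div_sub_div _ _ (by positivity) (by positivity), ← mul_div_assoc,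
          div_le_div_iff₀ (by positivity) (by positivity)]
        nlinarith [mul_nonneg hN hN]
      linarith
    · rw [if_neg hc, add_zero]
      refine ih.trans ?_
      have : 1 / (max ((N : ℝ) + 1 + 1) M) ≤ 1 / (max ((N : ℝ) + 1) M) := by
        gcongr; linarith
      linarith

lemma a_sum (k : ℕ) (hk : 2 ≤ k) (s Y : ℝ) (hs : -1 < s) (hs2 : s ≤ 1 / 2) (hY : 1 ≤ Y) :
    Summable (fun n : ℕ+ => (n : ℝ) ^ s / max (((n : ℝ) / Y) ^ k) 1) ∧
    ∑' n : ℕ+, (n : ℝ) ^ s / max (((n : ℝ) / Y) ^ k) 1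
      ≤ (1 / (1 + min s 0) + 5) * Y ^ (1 + s) := by
  have hY0 : 0 < Y := by linarith
  set u := min s 0 with hu
  have hu1 : -1 < u := lt_min hs (by norm_num)
  have hu0 : u ≤ 0 := min_le_right _ _
  have hus : u ≤ s := min_le_left _ _
  have h1u : 0 < 1 + u := by linarith
  refine pnat_tsum_bound (fun n => (n : ℝ) ^ s / max (((n : ℝ) / Y) ^ k) 1) _ ?_ ?_
  · intro n _; positivity
  intro N
  have hpt : ∀ n ∈ Finset.Icc 1 N, (n : ℝ) ^ s / max (((n : ℝ) / Y) ^ k) 1 ≤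
      Y ^ (s - u) * (if (n : ℝ) ≤ Y then (n : ℝ) ^ u else 0) +
      Y ^ (s + 3 / 2) * (if Y < (n : ℝ) then (n : ℝ) ^ (-(3 / 2) : ℝ) else 0) := by
    intro n hn
    have hn1 : (1 : ℝ) ≤ n := by exact_mod_cast (Finset.mem_Icc.1 hn).1
    have hn0 : (0 : ℝ) < n := by linarith
    by_cases hc : (n : ℝ) ≤ Y
    · rw [if_pos hc, if_neg (not_lt.2 hc), mul_zero, add_zero]
      calc _ ≤ (n : ℝ) ^ s := div_le_self (by positivity) (le_max_right _ _)
        _ = (n : ℝ) ^ (s - u) * (n : ℝ) ^ u := by rw [← Real.rpow_add hn0]; congr 1; ring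
        _ ≤ _ := by gcongr
    · rw [if_neg hc, if_pos (not_le.1 hc), mul_zero, zero_add]
      have hc' := not_le.1 hc
      have hr : 1 ≤ (n : ℝ) / Y := by rw [le_div_iff₀ hY0]; linarith
      calc _ ≤ (n : ℝ) ^ s / ((n : ℝ) / Y) ^ 2 := by
            gcongr
            exact (pow_le_pow_right₀ hr hk).trans (le_max_left _ _)
        _ = (n : ℝ) ^ (s - 1 / 2) * (Y ^ (2 : ℝ) * (n : ℝ) ^ (-(3 / 2) : ℝ)) := by
            have : (n : ℝ) ^ s = (n : ℝ) ^ (s - 1 / 2) * (n : ℝ) ^ (-(3 / 2) : ℝ) * (n : ℝ) ^ (2 : ℝ) := by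
              rw [← Real.rpow_add hn0, ← Real.rpow_add hn0]; congr 1; ring
            rw [this, Real.rpow_two, Real.rpow_two]
            field_simp
        _ ≤ Y ^ (s - 1 / 2) * (Y ^ (2 : ℝ) * (n : ℝ) ^ (-(3 / 2) : ℝ)) := by
            have := Real.rpow_le_rpow_of_nonpos hY0 hc'.le (by linarith : s - 1 / 2 ≤ 0)
            gcongr
        _ = _ := by
            rw [← mul_assoc, ← Real.rpow_add hY0]; congr 2; ring
  refine (Finset.sum_le_sum hpt).trans ?_
  rw [Finset.sum_add_distrib, ← Finset.mul_sum, ← Finset.mul_sum]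
  have hl : ∑ n ∈ Finset.Icc 1 N, (if (n : ℝ) ≤ Y then (n : ℝ) ^ u else 0) ≤ Y ^ (1 + u) / (1 + u) := by
    refine (low_sum u Y hu1 hu0 hY N).trans ?_
    have : 0 ≤ min (N : ℝ) Y := le_min (by positivity) hY0.le
    gcongr
    exact min_le_right _ _
  have hh : ∑ n ∈ Finset.Icc 1 N, (if Y < (n : ℝ) then (n : ℝ) ^ (-(3 / 2) : ℝ) else 0) ≤ 5 * Y ^ (-(1 / 2) : ℝ) := by
    refine (high_sum Y hY N).trans ?_
    have : 0 ≤ (max ((N : ℝ) + 1) Y) ^ (-(1 / 2) : ℝ) := by positivity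
    linarith
  calc _ ≤ Y ^ (s - u) * (Y ^ (1 + u) / (1 + u)) + Y ^ (s + 3 / 2) * (5 * Y ^ (-(1 / 2) : ℝ)) := by gcongr
    _ = (Y ^ (s - u) * Y ^ (1 + u)) / (1 + u) + 5 * (Y ^ (s + 3 / 2) * Y ^ (-(1 / 2) : ℝ)) := by ring
    _ = _ := by
      rw [← Real.rpow_add hY0, ← Real.rpow_add hY0,
        show s - u + (1 + u) = 1 + s by ring, show s + 3 / 2 + -(1 / 2) = 1 + s by ring]
      ring

/-- The inner sum over `l`. -/
lemma inner_l_tail_sum (k : ℕ) (H e Y g : ℝ) (hH : 0 < H) (hY : 0 < Y) (hYk : Y ^ k * H ^ e = H)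
    (hg : 0 < g) :
    ∑' l : ℕ+, (if H ^ e ≤ H * (l : ℝ) / g ^ k then g ^ (2 * k) / (l : ℝ) ^ 2 else 0)
      ≤ 2 * g ^ (2 * k) / max ((g / Y) ^ k) 1 := by
  have hHe : 0 < H ^ e := by positivity
  refine (pnat_tsum_bound (fun l => if H ^ e ≤ H * (l : ℝ) / g ^ k
    then g ^ (2 * k) / (l : ℝ) ^ 2 else 0) _ ?_ ?_).2
  · intro n _
    split_ifs <;> positivity
  intro N
  set M := max ((g / Y) ^ k) 1 with hM
  have h1 : ∀ l ∈ Finset.Icc 1 N, (if H ^ e ≤ H * (l : ℝ) / g ^ k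
      then g ^ (2 * k) / (l : ℝ) ^ 2 else 0) = g ^ (2 * k) * (if M ≤ (l : ℝ) then 1 / (l : ℝ) ^ 2 else 0) := by
    intro l hl
    have hl1 : (1 : ℝ) ≤ l := by exact_mod_cast (Finset.mem_Icc.1 hl).1
    have hiff : H ^ e ≤ H * (l : ℝ) / g ^ k ↔ M ≤ (l : ℝ) := by
      rw [hM, max_le_iff, and_iff_left hl1, div_pow, div_le_iff₀ (by positivity),
        le_div_iff₀ (by positivity)]
      nth_rewrite 2 [← hYk]
      rw [show Y ^ k * H ^ e * (l : ℝ) = H ^ e * (l * Y ^ k) by ring]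
      exact mul_le_mul_iff_right₀ hHe
    by_cases hc : M ≤ (l : ℝ)
    · rw [if_pos (hiff.2 hc), if_pos hc]; ring
    · rw [if_neg (fun h => hc (hiff.1 h)), if_neg hc, mul_zero]
  rw [Finset.sum_congr rfl h1, ← Finset.mul_sum]
  have hM1 : 1 ≤ M := le_max_right _ _
  have h2 := sq_sum M hM1 N
  have h3 : 0 ≤ 1 / (max ((N : ℝ) + 1) M) := by positivity
  calc _ ≤ g ^ (2 * k) * (2 * (1 / M)) := by gcongr; linarith
    _ = _ := by ring

/-- Tail estimate for the comparison of `S(y)²` with its truncated smooth approximation: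
for `k ≥ 2`, `0 ≤ α < 1/2`, sufficiently small `ε₁ > 0` and `|h(d)| ≤ C₀ d^{−α+ε₁}`,
for `H ≥ 2` and `ε' ∈ (0,1)`,
`∑_{d₁,d₂ ≥ 1} |h(d₁)h(d₂)|/(d₁^k d₂^k) ∑_{λ≥1} ((d₁,d₂)^{2k}/λ²) 𝟙[Hλ/(d₁,d₂)^k ≥ H^{ε'}]
  ≪ H^{(1−ε')(1−2α+2ε₁)/k}`. -/
theorem tail_indicator_sum_bound (k : ℕ) (hk : 2 ≤ k) (α : ℝ) (hα0 : 0 ≤ α)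
    (hα : α < 1 / 2) :
    ∃ ε₀ > 0, ∀ (ε₁ C₀ : ℝ) (h : ℕ → ℂ), 0 < ε₁ → ε₁ ≤ ε₀ →
      (∀ d : ℕ, 1 ≤ d → ‖h d‖ ≤ C₀ * (d : ℝ) ^ (-α + ε₁)) →
      ∃ C' > 0, ∀ H ε' : ℝ, 2 ≤ H → 0 < ε' → ε' < 1 →
        (∑' p : ℕ+ × ℕ+,
            ‖h p.1 * h p.2‖ / ((p.1 : ℝ) ^ k * (p.2 : ℝ) ^ k) *
              ∑' l : ℕ+,
                (if H ^ (ε' : ℝ) ≤ H * (l : ℝ) / ((Nat.gcd p.1 p.2 : ℝ)) ^ k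
                  then ((Nat.gcd p.1 p.2 : ℝ)) ^ (2 * k) / (l : ℝ) ^ 2 else 0))
          ≤ C' * H ^ ((1 - ε') * (1 - 2 * α + 2 * ε₁) / k) := by
  refine ⟨1 / 4, by norm_num, ?_⟩
  intro ε C₀ h hε hε4 hh
  have hC0 : 0 ≤ C₀ := by
    have := hh 1 le_rfl
    simp only [Nat.cast_one, Real.one_rpow, mul_one] at this
    exact (norm_nonneg _).trans this
  set s : ℝ := -2 * α + 2 * ε with hs
  set t : ℝ := -α + ε - k with ht
  have hk2 : (2 : ℝ) ≤ k := by exact_mod_cast hk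
  have hsb : Summable (fun n : ℕ+ => (n : ℝ) ^ t) := by
    have : Summable (fun n : ℕ => (n : ℝ) ^ t) := Real.summable_nat_rpow.2 (by linarith)
    exact this.comp_injective PNat.coe_injective
  set S : ℝ := ∑' n : ℕ+, (n : ℝ) ^ t with hS
  have hS0 : 0 ≤ S := tsum_nonneg (fun n => by positivity)
  have hu1 : -1 < min s 0 := lt_min (by linarith) (by norm_num)
  set A : ℝ := 1 / (1 + min s 0) + 5 with hA
  have hA0 : 0 ≤ A := by
    have : 0 < 1 + min s 0 := by linarith
    positivity
  refine ⟨2 * C₀ ^ 2 * (A * (S * S)) + 1, by positivity, ?_⟩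
  intro H ε' hH hε' hε'1
  have hH0 : 0 < H := by linarith
  set Y : ℝ := H ^ ((1 - ε') / k) with hYdef
  have hY0 : 0 < Y := by positivity
  have hY1 : 1 ≤ Y := Real.one_le_rpow (by linarith) (div_nonneg (by linarith) (by linarith))
  have hYk : Y ^ k * H ^ ε' = H := by
    rw [hYdef, ← Real.rpow_natCast, ← Real.rpow_mul hH0.le, ← Real.rpow_add hH0,
      div_mul_cancel₀ _ (by positivity), sub_add_cancel, Real.rpow_one]
  have hYs : H ^ ((1 - ε') * (1 - 2 * α + 2 * ε) / k) = Y ^ (1 + s) := by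
    rw [hYdef, ← Real.rpow_mul hH0.le, hs]
    congr 1; ring
  rw [hYs]
  obtain ⟨ha, hab⟩ := a_sum k hk s Y (by linarith) (by linarith) hY1
  set a : ℕ+ → ℝ := fun n => (n : ℝ) ^ s / max (((n : ℝ) / Y) ^ k) 1 with hadef
  set b : ℕ+ → ℝ := fun n => (n : ℝ) ^ t with hbdef
  have ha0 : ∀ n, 0 ≤ a n := fun n => by positivity
  have hb0 : ∀ n, 0 ≤ b n := fun n => by positivity
  have hbb : Summable (fun q : ℕ+ × ℕ+ => b q.1 * b q.2) := hsb.mul_of_nonneg hsb hb0 hb0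
  have hG : Summable (fun q : ℕ+ × (ℕ+ × ℕ+) => a q.1 * (b q.2.1 * b q.2.2)) :=
    ha.mul_of_nonneg (g := fun q : ℕ+ × ℕ+ => b q.1 * b q.2) hbb ha0
      (fun q => mul_nonneg (hb0 _) (hb0 _))
  have hGt : ∑' q : ℕ+ × (ℕ+ × ℕ+), a q.1 * (b q.2.1 * b q.2.2) = (∑' n, a n) * (S * S) := by
    rw [hS, hsb.tsum_mul_tsum hsb hbb,
      ha.tsum_mul_tsum (g := fun q : ℕ+ × ℕ+ => b q.1 * b q.2) hbb hG]
  -- the parametrisation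
  have hex : ∀ p : ℕ+ × ℕ+, ∃ q : ℕ+ × (ℕ+ × ℕ+), (q.1 : ℕ) = Nat.gcd p.1 p.2 ∧
      p.1 = q.1 * q.2.1 ∧ p.2 = q.1 * q.2.2 := by
    intro p
    have hg : 0 < Nat.gcd p.1 p.2 := Nat.gcd_pos_of_pos_left _ p.1.pos
    obtain ⟨x, hx⟩ := Nat.gcd_dvd_left p.1 p.2
    obtain ⟨y, hy⟩ := Nat.gcd_dvd_right p.1 p.2
    have hx0 : 0 < x := Nat.pos_of_ne_zero (fun h0 => by
      rw [h0, mul_zero] at hx; exact p.1.pos.ne' hx)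
    have hy0 : 0 < y := Nat.pos_of_ne_zero (fun h0 => by
      rw [h0, mul_zero] at hy; exact p.2.pos.ne' hy)
    refine ⟨(⟨_, hg⟩, (⟨x, hx0⟩, ⟨y, hy0⟩)), rfl, PNat.eq ?_, PNat.eq ?_⟩
    · rw [PNat.mul_coe]; exact hx
    · rw [PNat.mul_coe]; exact hy
  choose φ hφg hφ1 hφ2 using hex
  have hinj : Function.Injective φ := by
    intro p p' hpp
    apply Prod.ext
    · rw [hφ1 p, hφ1 p', hpp]
    · rw [hφ2 p, hφ2 p', hpp]
  set G : ℕ+ × (ℕ+ × ℕ+) → ℝ := fun q => a q.1 * (b q.2.1 * b q.2.2) with hGdef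
  have hG0 : ∀ q, 0 ≤ G q := fun q => mul_nonneg (ha0 _) (mul_nonneg (hb0 _) (hb0 _))
  have hGφ : Summable (fun p => 2 * C₀ ^ 2 * G (φ p)) := (hG.comp_injective hinj).mul_left _
  have hin0 : ∀ p : ℕ+ × ℕ+, 0 ≤ ∑' l : ℕ+,
      (if H ^ (ε' : ℝ) ≤ H * (l : ℝ) / ((Nat.gcd p.1 p.2 : ℝ)) ^ k
        then ((Nat.gcd p.1 p.2 : ℝ)) ^ (2 * k) / (l : ℝ) ^ 2 else 0) := by
    intro p
    apply tsum_nonneg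
    intro l
    split_ifs <;> positivity
  have hF : ∀ p : ℕ+ × ℕ+, ‖h p.1 * h p.2‖ / ((p.1 : ℝ) ^ k * (p.2 : ℝ) ^ k) *
              ∑' l : ℕ+,
                (if H ^ (ε' : ℝ) ≤ H * (l : ℝ) / ((Nat.gcd p.1 p.2 : ℝ)) ^ k
                  then ((Nat.gcd p.1 p.2 : ℝ)) ^ (2 * k) / (l : ℝ) ^ 2 else 0)
        ≤ 2 * C₀ ^ 2 * G (φ p) := by
    intro p
    have hgc := hφg p
    have h1 := hφ1 p
    have h2 := hφ2 p
    generalize φ p = q at *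
    obtain ⟨g, x, y⟩ := q
    dsimp only at hgc h1 h2
    rw [← hgc]
    have hg0 : (0 : ℝ) < (g : ℕ) := by exact_mod_cast g.pos
    have hx0 : (0 : ℝ) < (x : ℕ) := by exact_mod_cast x.pos
    have hy0 : (0 : ℝ) < (y : ℕ) := by exact_mod_cast y.pos
    have hI := inner_l_tail_sum k H ε' Y g hH0 hY0 hYk hg0
    have hn1 := hh p.1 p.1.pos
    have hn2 := hh p.2 p.2.pos
    have c1 : ((p.1 : ℕ) : ℝ) = (g : ℕ) * (x : ℕ) := by rw [h1]; push_cast; ring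
    have c2 : ((p.2 : ℕ) : ℝ) = (g : ℕ) * (y : ℕ) := by rw [h2]; push_cast; ring
    rw [norm_mul]
    calc _ ≤ (C₀ * ((p.1 : ℕ) : ℝ) ^ (-α + ε)) * (C₀ * ((p.2 : ℕ) : ℝ) ^ (-α + ε)) /
            (((p.1 : ℕ) : ℝ) ^ k * ((p.2 : ℕ) : ℝ) ^ k) *
            (2 * ((g : ℕ) : ℝ) ^ (2 * k) / max ((((g : ℕ) : ℝ) / Y) ^ k) 1) := by
          gcongr
      _ = 2 * C₀ ^ 2 * G (g, x, y) := by
          simp only [hGdef, hadef, hbdef]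
          have hgs : ((g : ℕ) : ℝ) ^ s = ((g : ℕ) : ℝ) ^ (-α + ε) * ((g : ℕ) : ℝ) ^ (-α + ε) := by
            rw [← Real.rpow_add hg0, hs]; congr 1; ring
          rw [c1, c2, hgs, Real.mul_rpow hg0.le hx0.le, Real.mul_rpow hg0.le hy0.le, ht,
            Real.rpow_sub hx0, Real.rpow_sub hy0, Real.rpow_natCast, Real.rpow_natCast,
            mul_pow, mul_pow, two_mul k, pow_add]
          generalize ((g : ℕ) : ℝ) ^ (-α + ε) = P
          field_simp
  have hFs := Summable.of_nonneg_of_le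
    (fun p : ℕ+ × ℕ+ => mul_nonneg (by positivity) (hin0 p)) hF hGφ
  calc _ ≤ ∑' p, 2 * C₀ ^ 2 * G (φ p) := hFs.tsum_le_tsum hF hGφ
    _ = 2 * C₀ ^ 2 * ∑' p, G (φ p) := tsum_mul_left
    _ ≤ 2 * C₀ ^ 2 * ∑' q, G q := by
        gcongr
        exact tsum_comp_le_tsum_of_inj hG hG0 hinj
    _ = 2 * C₀ ^ 2 * ((∑' n, a n) * (S * S)) := by rw [hGt]
    _ ≤ 2 * C₀ ^ 2 * ((A * Y ^ (1 + s)) * (S * S)) := by gcongr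
    _ ≤ (2 * C₀ ^ 2 * (A * (S * S)) + 1) * Y ^ (1 + s) := by
        have : 0 ≤ Y ^ (1 + s) := by positivity
        nlinarith
end

section
/- For real σ ≥ 1/2 and t ≥ 2, the Riemann zeta function satisfies |ζ(σ + it)| ≪ (t^{(1−σ)/3} + 1)·log t. -/
open Real in
/-- `e(x) = exp(2π i x)`. -/
noncomputable def ee (x : ℝ) : ℂ := Complex.exp (((2 * π * x : ℝ) : ℂ) * Complex.I)

lemma ee_add (x y : ℝ) : ee (x + y) = ee x * ee y := by
  unfold ee
  rw [← Complex.exp_add]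
  congr 1
  push_cast
  ring

lemma norm_ee (x : ℝ) : ‖ee x‖ = 1 := by
  unfold ee
  exact Complex.norm_exp_ofReal_mul_I _

lemma ee_int (k : ℤ) : ee k = 1 := by
  unfold ee
  rw [Complex.exp_eq_one_iff]
  refine ⟨k, ?_⟩
  push_cast
  ring

lemma ee_sub_int (x : ℝ) (k : ℤ) : ee (x - k) = ee x := by
  have h := ee_add (x - k) k
  rw [ee_int, mul_one, sub_add_cancel] at h
  exact h.symm

lemma conj_ee (x : ℝ) : (starRingEnd ℂ) (ee x) = ee (-x) := by
  unfold ee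
  rw [← Complex.exp_conj]
  congr 1
  rw [map_mul, Complex.conj_ofReal, Complex.conj_I]
  push_cast
  ring

/-- `cc x = 1 / (1 - e(x))`. -/
noncomputable def cc (x : ℝ) : ℂ :=
  1 / 2 + Complex.I / 2 * ((Real.cos (Real.pi * x) / Real.sin (Real.pi * x) : ℝ) : ℂ)

lemma cc_mul (x : ℝ) (h : Real.sin (Real.pi * x) ≠ 0) : cc x * (1 - ee x) = 1 := by
  have h1 : ee x = (Real.cos (Real.pi * x) + Real.sin (Real.pi * x) * Complex.I) ^ 2 := by
    unfold ee
    rw [Complex.ofReal_cos, Complex.ofReal_sin, ← Complex.exp_mul_I, ← Complex.exp_nat_mul]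
    congr 1
    push_cast
    ring
  rw [h1]
  unfold cc
  have h2 := Real.sin_sq_add_cos_sq (Real.pi * x)
  generalize Real.sin (Real.pi * x) = S at *
  generalize Real.cos (Real.pi * x) = C at *
  have h3 : (S : ℂ) ≠ 0 := by exact_mod_cast h
  have h4 : (S : ℂ) ^ 2 + (C : ℂ) ^ 2 = 1 := by exact_mod_cast h2
  have hI := Complex.I_sq
  have h5 : (1 : ℂ) - (C + S * Complex.I) ^ 2 = 2 * S * (S - C * Complex.I) := by
    linear_combination (-S ^ 2 : ℂ) * hI - h4
  rw [h5]
  push_cast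
  have h6 : (C : ℂ) / S * S = C := by field_simp
  linear_combination (Complex.I * (S - C * Complex.I)) * h6 - (C : ℂ) ^ 2 * hI + h4

lemma sin_lower {θ x : ℝ} (h0 : 0 < θ) (h1 : θ ≤ x) (h2 : x ≤ 1 - θ) :
    2 * θ ≤ Real.sin (Real.pi * x) := by
  have hpi := Real.pi_pos
  have key : ∀ y : ℝ, θ ≤ y → y ≤ 1 / 2 → 2 * θ ≤ Real.sin (Real.pi * y) := by
    intro y hy hy2
    have := Real.mul_le_sin (x := Real.pi * y) (by nlinarith) (by nlinarith)
    have e : 2 / Real.pi * (Real.pi * y) = 2 * y := by field_simp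
    linarith
  rcases le_total x (1 / 2) with h | h
  · exact key x h1 h
  · have := key (1 - x) (by linarith) (by linarith)
    rwa [mul_sub, mul_one, Real.sin_pi_sub] at this

lemma cot_anti {x y : ℝ} (hx : 0 < Real.sin (Real.pi * x)) (hy : 0 < Real.sin (Real.pi * y))
    (hxy : x ≤ y) (h1 : y ≤ x + 1) :
    Real.cos (Real.pi * y) / Real.sin (Real.pi * y) ≤
      Real.cos (Real.pi * x) / Real.sin (Real.pi * x) := by
  have hpi := Real.pi_pos
  rw [div_le_div_iff₀ hy hx]
  have : 0 ≤ Real.sin (Real.pi * y - Real.pi * x) :=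
    Real.sin_nonneg_of_nonneg_of_le_pi (by nlinarith) (by nlinarith)
  rw [Real.sin_sub] at this
  nlinarith

lemma norm_cc_sub (x y : ℝ) : ‖cc y - cc x‖ =
    |Real.cos (Real.pi * y) / Real.sin (Real.pi * y) -
      Real.cos (Real.pi * x) / Real.sin (Real.pi * x)| / 2 := by
  have : cc y - cc x = Complex.I / 2 * ((Real.cos (Real.pi * y) / Real.sin (Real.pi * y) -
      Real.cos (Real.pi * x) / Real.sin (Real.pi * x) : ℝ) : ℂ) := by
    unfold cc; push_cast; ring
  rw [this, norm_mul, Complex.norm_real, Real.norm_eq_abs]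
  simp
  ring

lemma abs_cot_le {θ x : ℝ} (h0 : 0 < θ) (h : 2 * θ ≤ Real.sin (Real.pi * x)) :
    |Real.cos (Real.pi * x) / Real.sin (Real.pi * x)| ≤ 1 / (2 * θ) := by
  rw [abs_div, abs_of_pos (by linarith : 0 < Real.sin (Real.pi * x))]
  exact div_le_div₀ zero_le_one (Real.abs_cos_le_one _) (by positivity) h

lemma norm_cc_le {θ x : ℝ} (h0 : 0 < θ) (h : 2 * θ ≤ Real.sin (Real.pi * x)) :
    ‖cc x‖ ≤ 1 / (2 * θ) := by
  have h1 := abs_cot_le h0 h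
  have h2 : 1 ≤ 1 / (2 * θ) := by
    rw [le_div_iff₀ (by positivity)]
    linarith [Real.sin_le_one (Real.pi * x)]
  unfold cc
  refine (norm_add_le _ _).trans ?_
  rw [norm_mul, Complex.norm_real, Real.norm_eq_abs]
  simp only [norm_div, Complex.norm_I, norm_one, RCLike.norm_ofNat]
  linarith

/-- Kusmin–Landau. -/
lemma kusmin_landau (f : ℕ → ℝ) (a b : ℕ) (hab : a ≤ b) (θ : ℝ) (h0 : 0 < θ) (k : ℤ)
    (hmono : ∀ n, a ≤ n → n < b → f (n + 1) - f n ≤ f (n + 2) - f (n + 1))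
    (hl : ∀ n, a ≤ n → n ≤ b → k + θ ≤ f (n + 1) - f n)
    (hu : ∀ n, a ≤ n → n ≤ b → f (n + 1) - f n ≤ k + 1 - θ) :
    ‖∑ n ∈ Finset.Icc a b, ee (f n)‖ ≤ 2 / θ := by
  set g : ℕ → ℝ := fun n => f (n + 1) - f n - k with hg
  have hs : ∀ n, a ≤ n → n ≤ b → 2 * θ ≤ Real.sin (Real.pi * g n) := fun n h1 h2 =>
    sin_lower h0 (by have := hl n h1 h2; simp only [hg]; linarith)
      (by have := hu n h1 h2; simp only [hg]; linarith)
  have hstep : ∀ n, a ≤ n → n ≤ b → ee (f n) + ee (f (n + 1)) * cc (g n) = ee (f n) * cc (g n) := by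
    intro n h1 h2
    have e1 : ee (f (n + 1)) = ee (f n) * ee (g n) := by
      rw [ee_sub_int, ← ee_add]; congr 1; ring
    have e2 := cc_mul (g n) (by have := hs n h1 h2; linarith)
    rw [e1]
    linear_combination - ee (f n) * e2
  have main : ∀ m, a ≤ m → m ≤ b → ‖∑ n ∈ Finset.Icc a m, ee (f n) + ee (f (m + 1)) * cc (g m)‖ ≤
      ‖cc (g a)‖ + (Real.cos (Real.pi * g a) / Real.sin (Real.pi * g a) -
        Real.cos (Real.pi * g m) / Real.sin (Real.pi * g m)) / 2 := by
    intro m hm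
    induction m, hm using Nat.le_induction with
    | base =>
      intro h
      rw [Finset.Icc_self, Finset.sum_singleton, hstep a le_rfl h, norm_mul, norm_ee]
      simp
    | succ m hm ih =>
      intro h
      have ih' := ih (by omega)
      rw [Finset.sum_Icc_succ_top (by omega), add_comm (∑ n ∈ Finset.Icc a m, ee (f n))]
      have e := hstep (m + 1) (by omega) h
      have e2 : ee (f (m + 1)) + ∑ n ∈ Finset.Icc a m, ee (f n) +
          ee (f (m + 1 + 1)) * cc (g (m + 1)) =
          (∑ n ∈ Finset.Icc a m, ee (f n) + ee (f (m + 1)) * cc (g m)) +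
          ee (f (m + 1)) * (cc (g (m + 1)) - cc (g m)) := by
        linear_combination e
      rw [e2]
      refine (norm_add_le _ _).trans ?_
      rw [norm_mul, norm_ee, one_mul, norm_cc_sub]
      have hc := cot_anti (x := g m) (y := g (m + 1))
        (by linarith [hs m hm (by omega)]) (by linarith [hs (m + 1) (by omega) h])
        (by have := hmono m hm (by omega); simp only [hg]; linarith)
        (by have := hl m hm (by omega); have := hu (m + 1) (by omega) h
            simp only [hg]; linarith)
      rw [abs_of_nonpos (by linarith)]
      linarith
  have h1 := main b hab le_rfl
  have ha := norm_cc_le h0 (hs a le_rfl hab)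
  have hb := norm_cc_le h0 (hs b hab le_rfl)
  have ca := abs_le.1 (abs_cot_le h0 (hs a le_rfl hab))
  have cb := abs_le.1 (abs_cot_le h0 (hs b hab le_rfl))
  have h2 : ‖∑ n ∈ Finset.Icc a b, ee (f n)‖ ≤
      ‖∑ n ∈ Finset.Icc a b, ee (f n) + ee (f (b + 1)) * cc (g b)‖ + ‖ee (f (b + 1)) * cc (g b)‖ := by
    have := norm_sub_le (∑ n ∈ Finset.Icc a b, ee (f n) + ee (f (b + 1)) * cc (g b))
      (ee (f (b + 1)) * cc (g b))
    rwa [add_sub_cancel_right] at this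
  rw [norm_mul, norm_ee, one_mul] at h2
  have h3 : 1 / (2 * θ) = (2 / θ) / 4 := by field_simp; norm_num
  have h4 : 0 < 2 / θ := by positivity
  rw [h3] at ha hb ca cb
  linarith [ca.1, ca.2, cb.1, cb.2]

lemma card_le_of_gap (g : ℕ → ℝ) (M : ℕ) (lam δ : ℝ) (hlam : 0 < lam) (hδ : 0 ≤ δ)
    (hgap : ∀ m n, m ≤ n → n < M → lam * (n - m : ℝ) ≤ g n - g m)
    (s : Finset ℕ) (hs : ∀ n ∈ s, n < M) (hd : ∀ m ∈ s, ∀ n ∈ s, g n - g m ≤ δ) :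
    (s.card : ℝ) ≤ δ / lam + 1 := by
  rcases s.eq_empty_or_nonempty with rfl | hne
  · simp; positivity
  set a := s.min' hne
  set b := s.max' hne
  have hab : a ≤ b := s.min'_le_max' hne
  have hsub : s ⊆ Finset.Icc a b := fun n hn =>
    Finset.mem_Icc.2 ⟨s.min'_le n hn, s.le_max' n hn⟩
  have h1 := Finset.card_le_card hsub
  rw [Nat.card_Icc] at h1
  have h2 : (s.card : ℝ) ≤ (b : ℝ) - a + 1 := by
    have : s.card + a ≤ b + 1 := by omega
    have : (s.card : ℝ) + a ≤ b + 1 := by exact_mod_cast this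
    linarith
  have h3 := hgap a b hab (hs b (s.max'_mem hne))
  have h4 := hd a (s.min'_mem hne) b (s.max'_mem hne)
  have h5 : (b : ℝ) - a ≤ δ / lam := by
    rw [le_div_iff₀ hlam]; linarith
  linarith

lemma norm_sum_ee_le (f : ℕ → ℝ) (s : Finset ℕ) : ‖∑ n ∈ s, ee (f n)‖ ≤ s.card := by
  refine (norm_sum_le _ _).trans ?_
  simp [norm_ee]

/-- Discrete second derivative test. -/
lemma second_test (f : ℕ → ℝ) (M : ℕ) (lam : ℝ) (hlam : 0 < lam)
    (hl : ∀ n < M, lam ≤ f (n + 2) - 2 * f (n + 1) + f n)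
    (hu : ∀ n < M, f (n + 2) - 2 * f (n + 1) + f n ≤ 18 * lam) :
    ‖∑ n ∈ Finset.range M, ee (f n)‖ ≤ 90 * (M * √lam + 1 / √lam) := by
  have hsq : 0 < √lam := Real.sqrt_pos.2 hlam
  have hss : √lam * √lam = lam := Real.mul_self_sqrt hlam.le
  rcases le_or_gt (1 / 2) √lam with hbig | hsmall
  · refine (norm_sum_ee_le f _).trans ?_
    rw [Finset.card_range]
    have : 0 < 1 / √lam := by positivity
    have hM : (0 : ℝ) ≤ M := by positivity
    nlinarith
  rcases Nat.eq_zero_or_pos M with rfl | hMpos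
  · simp
  set g : ℕ → ℝ := fun n => f (n + 1) - f n with hg
  have hgap : ∀ m n, m ≤ n → n < M → lam * (n - m : ℝ) ≤ g n - g m ∧
      g n - g m ≤ 18 * lam * (n - m : ℝ) := by
    intro m n hmn
    induction n, hmn using Nat.le_induction with
    | base => intro _; simp
    | succ n hmn ih =>
      intro h
      have i1 := ih (by omega)
      have a1 := hl n (by omega)
      have a2 := hu n (by omega)
      have e : g (n + 1) - g n = f (n + 2) - 2 * f (n + 1) + f n := by
        simp only [hg]; ring
      push_cast
      constructor <;> linarith [i1.1, i1.2]
  have hmono : ∀ m n, m ≤ n → n < M → g m ≤ g n := by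
    intro m n hmn hn
    have := (hgap m n hmn hn).1
    have h2 : (m : ℝ) ≤ n := by exact_mod_cast hmn
    nlinarith
  set δ := √lam with hδ
  set K := Finset.Icc ⌊g 0⌋ ⌊g (M - 1)⌋ with hK
  have hmaps : ∀ n ∈ Finset.range M, ⌊g n⌋ ∈ K := by
    intro n hn
    rw [Finset.mem_range] at hn
    exact Finset.mem_Icc.2 ⟨Int.floor_le_floor (hmono 0 n (by omega) hn),
      Int.floor_le_floor (hmono n (M - 1) (by omega) (by omega))⟩
  rw [← Finset.sum_fiberwise_of_maps_to hmaps]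
  have hfib : ∀ k ∈ K, ‖∑ n ∈ Finset.range M with ⌊g n⌋ = k, ee (f n)‖ ≤ 5 / δ := by
    intro k _
    rw [← Finset.sum_filter_add_sum_filter_not _ (fun n => k + δ ≤ g n ∧ g n ≤ k + 1 - δ)]
    have hfar : ‖∑ n ∈ {n ∈ {n ∈ Finset.range M | ⌊g n⌋ = k} | k + δ ≤ g n ∧ g n ≤ k + 1 - δ},
        ee (f n)‖ ≤ 2 / δ := by
      set s := {n ∈ {n ∈ Finset.range M | ⌊g n⌋ = k} | k + δ ≤ g n ∧ g n ≤ k + 1 - δ} with hs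
      rcases s.eq_empty_or_nonempty with h | hne
      · rw [h]; simp; positivity
      have ha := s.min'_mem hne
      have hb := s.max'_mem hne
      set a := s.min' hne with haa
      set b := s.max' hne with hbb
      have hab : a ≤ b := s.min'_le_max' hne
      simp only [hs, Finset.mem_filter, Finset.mem_range] at ha hb
      have hsI : s = Finset.Icc a b := by
        ext n
        constructor
        · intro hn
          exact Finset.mem_Icc.2 ⟨s.min'_le n hn, s.le_max' n hn⟩
        · intro hn
          rw [Finset.mem_Icc] at hn
          have hnM : n < M := by omega
          have g1 := hmono a n hn.1 hnM
          have g2 := hmono n b hn.2 hb.1.1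
          simp only [hs, Finset.mem_filter, Finset.mem_range]
          refine ⟨⟨hnM, ?_⟩, by linarith [ha.2.1], by linarith [hb.2.2]⟩
          rw [Int.floor_eq_iff]
          constructor <;> linarith [ha.2.1, hb.2.2]
      rw [hsI]
      refine kusmin_landau f a b hab δ hsq k ?_ ?_ ?_
      · intro n h1 h2
        exact hmono n (n + 1) (by omega) (by omega)
      · intro n h1 h2
        have : n ∈ s := by rw [hsI]; exact Finset.mem_Icc.2 ⟨h1, h2⟩
        simp only [hs, Finset.mem_filter] at this
        exact this.2.1
      · intro n h1 h2
        have : n ∈ s := by rw [hsI]; exact Finset.mem_Icc.2 ⟨h1, h2⟩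
        simp only [hs, Finset.mem_filter] at this
        exact this.2.2
    have hnear : ‖∑ n ∈ {n ∈ {n ∈ Finset.range M | ⌊g n⌋ = k} | ¬ (k + δ ≤ g n ∧ g n ≤ k + 1 - δ)},
        ee (f n)‖ ≤ 2 * (δ / lam + 1) := by
      refine (norm_sum_ee_le f _).trans ?_
      set A := {n ∈ Finset.range M | ⌊g n⌋ = k ∧ g n < k + δ} with hA
      set B := {n ∈ Finset.range M | ⌊g n⌋ = k ∧ k + 1 - δ < g n} with hB
      have hsub : {n ∈ {n ∈ Finset.range M | ⌊g n⌋ = k} | ¬ (k + δ ≤ g n ∧ g n ≤ k + 1 - δ)} ⊆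
          A ∪ B := by
        intro n hn
        simp only [Finset.mem_filter, Finset.mem_union, hA, hB] at hn ⊢
        by_cases h : g n < k + δ
        · exact Or.inl ⟨hn.1.1, hn.1.2, h⟩
        · right
          refine ⟨hn.1.1, hn.1.2, ?_⟩
          by_contra h'
          exact hn.2 ⟨not_lt.1 h, not_lt.1 h'⟩
      have c0 := (Finset.card_le_card hsub).trans (Finset.card_union_le A B)
      have c0' : (({n ∈ {n ∈ Finset.range M | ⌊g n⌋ = k} |
        ¬ (k + δ ≤ g n ∧ g n ≤ k + 1 - δ)}.card : ℕ) : ℝ) ≤ (A.card : ℝ) + B.card := by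
        exact_mod_cast c0
      have cA := card_le_of_gap g M lam δ hlam hsq.le (fun m n h1 h2 => (hgap m n h1 h2).1) A
        (fun n hn => by simp only [hA, Finset.mem_filter, Finset.mem_range] at hn; exact hn.1)
        (fun m hm n hn => by
          simp only [hA, Finset.mem_filter, Int.floor_eq_iff] at hm hn
          linarith [hm.2.1.1, hn.2.2])
      have cB := card_le_of_gap g M lam δ hlam hsq.le (fun m n h1 h2 => (hgap m n h1 h2).1) B
        (fun n hn => by simp only [hB, Finset.mem_filter, Finset.mem_range] at hn; exact hn.1)
        (fun m hm n hn => by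
          simp only [hB, Finset.mem_filter, Int.floor_eq_iff] at hm hn
          linarith [hm.2.2, hn.2.1.2])
      linarith
    refine (norm_add_le _ _).trans ?_
    have e1 : δ / lam = 1 / δ := by rw [← hss]; field_simp
    have e2 : 2 ≤ 1 / δ := by rw [le_div_iff₀ hsq]; linarith
    rw [e1] at hnear
    have e3 : 2 / δ = 2 * (1 / δ) := by ring
    have e5 : 5 / δ = 5 * (1 / δ) := by ring
    rw [e5]; rw [e3] at hfar
    linarith
  refine (norm_sum_le_of_le _ hfib).trans ?_
  rw [Finset.sum_const, nsmul_eq_mul, hK, Int.card_Icc]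
  have hcard : (((⌊g (M - 1)⌋ + 1 - ⌊g 0⌋).toNat : ℕ) : ℝ) ≤ 18 * lam * M + 2 := by
    have h1 : ⌊g 0⌋ ≤ ⌊g (M - 1)⌋ := Int.floor_le_floor (hmono 0 (M - 1) (by omega) (by omega))
    have h2 : (((⌊g (M - 1)⌋ + 1 - ⌊g 0⌋).toNat : ℕ) : ℝ) = ((⌊g (M - 1)⌋ + 1 - ⌊g 0⌋ : ℤ) : ℝ) := by
      rw [← Int.cast_natCast, Int.toNat_of_nonneg (by omega)]
    rw [h2]
    push_cast
    have h3 := (hgap 0 (M - 1) (by omega) (by omega)).2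
    have h4 := Int.floor_le (g (M - 1))
    have h5 := Int.lt_floor_add_one (g 0)
    have h6 : (((M - 1 : ℕ) : ℝ)) ≤ M := by exact_mod_cast Nat.sub_le M 1
    push_cast at h3
    nlinarith
  calc _ ≤ (18 * lam * M + 2) * (5 / δ) := by gcongr
    _ = 90 * (M * δ) + 10 * (1 / δ) := by
      rw [← hss]; field_simp; ring
    _ ≤ _ := by
      have : 0 < 1 / δ := by positivity
      linarith

lemma sum_shift (w : ℤ → ℂ) (M H : ℕ) (hw : ∀ n : ℤ, n ∉ Finset.Ico (0 : ℤ) M → w n = 0)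
    (h : ℕ) (hh : h < H) :
    ∑ m ∈ Finset.Ico (-(H : ℤ)) M, w (m + h) = ∑ m ∈ Finset.Ico (0 : ℤ) M, w m := by
  have e1 : ∑ m ∈ Finset.Ico (-(H : ℤ)) M, w (m + h) =
      ∑ m ∈ Finset.Ico (-(H : ℤ) + h) (M + h), w m := by
    rw [← Finset.image_add_right_Ico, Finset.sum_image]
    intro a _ b _ hab
    simpa using hab
  rw [e1]
  symm
  apply Finset.sum_subset
  · intro n hn
    rw [Finset.mem_Ico] at hn ⊢
    omega
  · intro n _ hn
    exact hw n hn

lemma sum_dist_le (B : ℕ → ℝ) (H : ℕ) (hB : ∀ h < H, 0 ≤ B h) (R : ℕ → ℝ) (a : ℕ) (ha : a < H)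
    (h1 : ∀ b < H, b ≤ a → R b ≤ B (a - b)) (h2 : ∀ b < H, a ≤ b → R b ≤ B (b - a)) :
    ∑ b ∈ Finset.range H, R b ≤ 2 * ∑ h ∈ Finset.range H, B h := by
  rw [← Finset.sum_filter_add_sum_filter_not (Finset.range H) (fun b => b ≤ a), two_mul]
  refine add_le_add ?_ ?_
  · calc _ ≤ ∑ b ∈ Finset.range H with b ≤ a, B (a - b) := by
          apply Finset.sum_le_sum
          intro b hb
          simp only [Finset.mem_filter, Finset.mem_range] at hb
          exact h1 b hb.1 hb.2
      _ = ∑ c ∈ Finset.image (fun b => a - b) {b ∈ Finset.range H | b ≤ a}, B c := by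
          rw [Finset.sum_image]
          intro x hx y hy hxy
          simp only [Finset.coe_filter, Finset.mem_range, Set.mem_ofPred_eq] at hx hy hxy
          omega
      _ ≤ _ := by
          apply Finset.sum_le_sum_of_subset_of_nonneg
          · intro c hc
            simp only [Finset.mem_image, Finset.mem_filter, Finset.mem_range] at hc ⊢
            omega
          · intro i hi _
            exact hB i (Finset.mem_range.1 hi)
  · calc _ ≤ ∑ b ∈ Finset.range H with ¬ b ≤ a, B (b - a) := by
          apply Finset.sum_le_sum
          intro b hb
          simp only [Finset.mem_filter, Finset.mem_range] at hb
          exact h2 b hb.1 (by omega)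
      _ = ∑ c ∈ Finset.image (fun b => b - a) {b ∈ Finset.range H | ¬ b ≤ a}, B c := by
          rw [Finset.sum_image]
          intro x hx y hy hxy
          simp only [Finset.coe_filter, Finset.mem_range, Set.mem_ofPred_eq] at hx hy hxy
          omega
      _ ≤ _ := by
          apply Finset.sum_le_sum_of_subset_of_nonneg
          · intro c hc
            simp only [Finset.mem_image, Finset.mem_filter, Finset.mem_range] at hc ⊢
            omega
          · intro i hi _
            exact hB i (Finset.mem_range.1 hi)

open ComplexConjugate in
/-- Weyl–van der Corput inequality. -/
lemma vdc (z : ℤ → ℂ) (M H : ℕ) (hz : ∀ n : ℤ, n ∉ Finset.Ico (0 : ℤ) M → z n = 0)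
    (B : ℕ → ℝ)
    (hB : ∀ h < H, ‖∑ m ∈ Finset.Ico (0 : ℤ) M, z m * conj (z (m + h))‖ ≤ B h) :
    (H : ℝ) ^ 2 * ‖∑ m ∈ Finset.Ico (0 : ℤ) M, z m‖ ^ 2 ≤
      (M + H) * (2 * H * ∑ h ∈ Finset.range H, B h) := by
  set S := ∑ m ∈ Finset.Ico (0 : ℤ) M, z m with hS
  set I := Finset.Ico (-(H : ℤ)) M with hI
  have hB0 : ∀ h < H, 0 ≤ B h := fun h hh => (norm_nonneg _).trans (hB h hh)
  have e1 : (H : ℂ) * S = ∑ m ∈ I, ∑ h ∈ Finset.range H, z (m + h) := by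
    rw [Finset.sum_comm]
    rw [Finset.sum_congr rfl (fun h hh => sum_shift z M H hz h (Finset.mem_range.1 hh))]
    simp [hS]
  have hcard : (I.card : ℝ) = M + H := by
    rw [hI, Int.card_Ico]
    have : ((M : ℤ) - -(H : ℤ)).toNat = M + H := by omega
    rw [this]; push_cast; ring
  have e2 : (H : ℝ) ^ 2 * ‖S‖ ^ 2 ≤ (M + H) * ∑ m ∈ I, ‖∑ h ∈ Finset.range H, z (m + h)‖ ^ 2 := by
    have : (H : ℝ) ^ 2 * ‖S‖ ^ 2 = ‖(H : ℂ) * S‖ ^ 2 := by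
      rw [norm_mul, mul_pow]; simp
    rw [this, e1, ← hcard]
    calc _ ≤ (∑ m ∈ I, ‖∑ h ∈ Finset.range H, z (m + h)‖) ^ 2 := by
          gcongr; exact norm_sum_le _ _
      _ ≤ _ := sq_sum_le_card_mul_sum_sq
  have hR : ∀ a b : ℕ, a ≤ b → b < H → ‖∑ m ∈ I, z (m + a) * conj (z (m + b))‖ ≤ B (b - a) := by
    intro a b hab hb
    have := sum_shift (fun m => z m * conj (z (m + (b - a : ℕ)))) M H
      (fun n hn => by simp only [hz n hn, zero_mul]) a (by omega)
    have h3 : ∑ m ∈ I, z (m + a) * conj (z (m + b)) =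
        ∑ m ∈ I, z (m + a) * conj (z (m + a + (b - a : ℕ))) := by
      apply Finset.sum_congr rfl
      intro m _
      congr 3
      omega
    rw [h3, this]
    exact hB _ (by omega)
  have hR' : ∀ a b : ℕ, b ≤ a → a < H → ‖∑ m ∈ I, z (m + a) * conj (z (m + b))‖ ≤ B (a - b) := by
    intro a b hab hb
    have := hR b a hab hb
    rw [← RCLike.norm_conj, map_sum] at this
    refine le_of_eq_of_le ?_ this
    congr 1
    apply Finset.sum_congr rfl
    intro m _
    rw [map_mul, Complex.conj_conj, mul_comm]
  have e3 : ((∑ m ∈ I, ‖∑ h ∈ Finset.range H, z (m + h)‖ ^ 2 : ℝ) : ℂ) =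
      ∑ a ∈ Finset.range H, ∑ b ∈ Finset.range H, ∑ m ∈ I, z (m + a) * conj (z (m + b)) := by
    push_cast
    have : ∀ m ∈ I, ((‖∑ h ∈ Finset.range H, z (m + h)‖ : ℂ)) ^ 2 =
        ∑ a ∈ Finset.range H, ∑ b ∈ Finset.range H, z (m + a) * conj (z (m + b)) := by
      intro m _
      rw [← Complex.mul_conj', map_sum, Finset.sum_mul_sum]
    rw [Finset.sum_congr rfl this, Finset.sum_comm]
    apply Finset.sum_congr rfl
    intro a _
    rw [Finset.sum_comm]
  have e4 : ∑ m ∈ I, ‖∑ h ∈ Finset.range H, z (m + h)‖ ^ 2 ≤ 2 * H * ∑ h ∈ Finset.range H, B h := by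
    have h1 : ∑ m ∈ I, ‖∑ h ∈ Finset.range H, z (m + h)‖ ^ 2 =
        ‖((∑ m ∈ I, ‖∑ h ∈ Finset.range H, z (m + h)‖ ^ 2 : ℝ) : ℂ)‖ := by
      rw [Complex.norm_real, Real.norm_of_nonneg]
      positivity
    rw [h1, e3]
    calc _ ≤ ∑ a ∈ Finset.range H, ∑ b ∈ Finset.range H,
          ‖∑ m ∈ I, z (m + a) * conj (z (m + b))‖ :=
          (norm_sum_le _ _).trans (Finset.sum_le_sum fun a _ => norm_sum_le _ _)
      _ ≤ ∑ a ∈ Finset.range H, 2 * ∑ h ∈ Finset.range H, B h := by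
          apply Finset.sum_le_sum
          intro a ha
          rw [Finset.mem_range] at ha
          exact sum_dist_le B H hB0 _ a ha (fun b hb hab => hR' a b hab ha)
            (fun b hb hab => hR a b hab hb)
      _ = _ := by simp; ring
  refine e2.trans ?_
  gcongr

/-- Weyl–van der Corput for exponential sums. -/
lemma vdc_ee (f : ℕ → ℝ) (M H : ℕ) (B : ℕ → ℝ)
    (hB : ∀ h < H, ‖∑ n ∈ Finset.range (M - h), ee (f n - f (n + h))‖ ≤ B h) :
    (H : ℝ) ^ 2 * ‖∑ n ∈ Finset.range M, ee (f n)‖ ^ 2 ≤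
      (M + H) * (2 * H * ∑ h ∈ Finset.range H, B h) := by
  set z : ℤ → ℂ := fun n => if n ∈ Finset.Ico (0 : ℤ) M then ee (f n.toNat) else 0 with hz
  have tr : ∀ w : ℤ → ℂ, ∑ m ∈ Finset.Ico (0 : ℤ) M, w m = ∑ n ∈ Finset.range M, w n := by
    intro w
    have : Finset.Ico (0 : ℤ) M = Finset.image (fun n : ℕ => (n : ℤ)) (Finset.range M) := by
      ext m
      simp only [Finset.mem_Ico, Finset.mem_image, Finset.mem_range]
      constructor
      · intro h
        exact ⟨m.toNat, by omega, by omega⟩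
      · rintro ⟨n, h1, h2⟩
        omega
    rw [this, Finset.sum_image]
    intro a _ b _ h
    simpa using h
  have hS : ∑ n ∈ Finset.range M, ee (f n) = ∑ m ∈ Finset.Ico (0 : ℤ) M, z m := by
    rw [tr]
    apply Finset.sum_congr rfl
    intro n hn
    rw [Finset.mem_range] at hn
    simp [hz, hn]
  rw [hS]
  apply vdc z M H
  · intro n hn
    simp only [hz, if_neg hn]
  · intro h hh
    refine le_of_eq_of_le ?_ (hB h hh)
    congr 1
    rw [tr]
    symm
    have hsub : Finset.range (M - h) ⊆ Finset.range M := Finset.range_subset_range.2 (by omega)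
    rw [← Finset.sum_subset hsub]
    · apply Finset.sum_congr rfl
      intro n hn
      rw [Finset.mem_range] at hn
      have h1 : ((n : ℤ)) ∈ Finset.Ico (0 : ℤ) M := Finset.mem_Ico.2 (by omega)
      have h2 : ((n : ℤ) + h) ∈ Finset.Ico (0 : ℤ) M := Finset.mem_Ico.2 (by omega)
      simp only [hz, if_pos h1, if_pos h2]
      rw [conj_ee, ← ee_add]
      have : ((n : ℤ) + h).toNat = n + h := by omega
      rw [this, Int.toNat_natCast, sub_eq_add_neg]
    · intro n _ hn
      rw [Finset.mem_range] at hn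
      have h2 : ((n : ℤ) + h) ∉ Finset.Ico (0 : ℤ) M := by
        rw [Finset.mem_Ico]; omega
      simp only [hz, if_neg h2, map_zero, mul_zero]

/-- Minus the second difference of the logarithm. -/
noncomputable def Dlog (m : ℝ) : ℝ := 2 * Real.log (m + 1) - Real.log m - Real.log (m + 2)

lemma Dlog_eq (m : ℝ) (hm : 0 < m) : Dlog m = Real.log ((m + 1) ^ 2 / (m * (m + 2))) := by
  unfold Dlog
  rw [Real.log_div (by positivity) (by positivity), Real.log_pow,
    Real.log_mul (by positivity) (by positivity)]
  push_cast; ring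

lemma Dlog_lower (m : ℝ) (hm : 0 < m) : 1 / (m + 1) ^ 2 ≤ Dlog m := by
  rw [Dlog_eq m hm]
  refine le_trans (le_of_eq ?_) (Real.one_sub_inv_le_log_of_pos (by positivity))
  field_simp; ring

lemma Dlog_upper (m : ℝ) (hm : 0 < m) : Dlog m ≤ 1 / (m * (m + 2)) := by
  rw [Dlog_eq m hm]
  refine le_trans (Real.log_le_sub_one_of_pos (by positivity)) (le_of_eq ?_)
  field_simp; ring

lemma Dlog_sub (m h : ℝ) (hm : 0 < m) (hh : 0 ≤ h) : Dlog m - Dlog (m + h) =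
    Real.log (((m + 1) ^ 2 * ((m + h) * (m + h + 2))) / ((m * (m + 2)) * (m + h + 1) ^ 2)) := by
  rw [Dlog_eq m hm, Dlog_eq (m + h) (by positivity), ← Real.log_div (by positivity) (by positivity)]
  congr 1
  field_simp

lemma Dlog_sub_lower (m h N : ℝ) (hm : 0 < m) (hh : 0 ≤ h) (hmN : m + 1 ≤ 2 * N) (hhN : h ≤ N) :
    h / (9 * N ^ 3) ≤ Dlog m - Dlog (m + h) := by
  have hN : 0 < N := by linarith
  rw [Dlog_sub m h hm hh]
  refine le_trans ?_ (Real.one_sub_inv_le_log_of_pos (by positivity))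
  have e : 1 - (((m + 1) ^ 2 * ((m + h) * (m + h + 2))) / ((m * (m + 2)) * (m + h + 1) ^ 2))⁻¹ =
      h * (2 * m + h + 2) / ((m + 1) ^ 2 * ((m + h) * (m + h + 2))) := by
    field_simp; ring
  rw [e]
  have h1 : (m + h) * (m + h + 2) ≤ (3 * N) ^ 2 := by nlinarith
  have h2 : h * (2 * (m + 1)) / ((m + 1) ^ 2 * (3 * N) ^ 2) ≤
      h * (2 * m + h + 2) / ((m + 1) ^ 2 * ((m + h) * (m + h + 2))) := by
    gcongr
    linarith
  refine le_trans ?_ h2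
  have e2 : h * (2 * (m + 1)) / ((m + 1) ^ 2 * (3 * N) ^ 2) = h / (9 * N ^ 2 * ((m + 1) / 2)) := by
    field_simp; ring
  rw [e2]
  apply div_le_div_of_nonneg_left hh (by positivity)
  have : 9 * N ^ 2 * ((m + 1) / 2) ≤ 9 * N ^ 2 * N := by gcongr; linarith
  linarith [this, (by ring : 9 * N ^ 2 * N = 9 * N ^ 3)]

lemma Dlog_sub_upper (m h N : ℝ) (hN : 0 < N) (hm : N ≤ m) (hh : 0 ≤ h) :
    Dlog m - Dlog (m + h) ≤ 2 * h / N ^ 3 := by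
  have hm0 : 0 < m := by linarith
  rw [Dlog_sub m h hm0 hh]
  refine le_trans (Real.log_le_sub_one_of_pos (by positivity)) ?_
  have e : ((m + 1) ^ 2 * ((m + h) * (m + h + 2))) / ((m * (m + 2)) * (m + h + 1) ^ 2) - 1 =
      h * (2 * m + h + 2) / ((m * (m + 2)) * (m + h + 1) ^ 2) := by
    field_simp; ring
  rw [e]
  calc _ ≤ h * (2 * (m + h + 1)) / ((m * (m + 2)) * (m + h + 1) ^ 2) := by gcongr; linarith
    _ = 2 * h / (m * (m + 2) * (m + h + 1)) := by field_simp
    _ ≤ 2 * h / (N * N * N) := by gcongr <;> linarith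
    _ = _ := by congr 1; ring

/-- Phase function. -/
noncomputable def ph (t : ℝ) (N n : ℕ) : ℝ := -(t / (2 * Real.pi)) * Real.log ((N : ℝ) + n)

lemma ph_second (t : ℝ) (N n : ℕ) : ph t N (n + 2) - 2 * ph t N (n + 1) + ph t N n =
    t / (2 * Real.pi) * Dlog ((N : ℝ) + n) := by
  unfold ph Dlog
  push_cast
  rw [← add_assoc, ← add_assoc]
  ring

lemma T_bounds (t : ℝ) (ht : 0 < t) : t / 7 ≤ t / (2 * Real.pi) ∧ t / (2 * Real.pi) ≤ t / 6 := by
  have h1 := Real.pi_gt_three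
  have h2 := Real.pi_lt_d2
  constructor
  · gcongr; linarith
  · gcongr; linarith

lemma bound_C (t : ℝ) (ht : 0 < t) (N M : ℕ) (hN : 1 ≤ N) (hM : M ≤ N) :
    ‖∑ n ∈ Finset.range M, ee (ph t N n)‖ ≤ 540 * (√t + N / √t) := by
  have hNr : (1 : ℝ) ≤ N := by exact_mod_cast hN
  have hMr : (M : ℝ) ≤ N := by exact_mod_cast hM
  obtain ⟨hT1, hT2⟩ := T_bounds t ht
  set T := t / (2 * Real.pi) with hT
  have hT0 : 0 < T := by linarith [div_pos ht (by norm_num : (0 : ℝ) < 7)]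
  have key := second_test (ph t N) M (T / (4 * N ^ 2)) (by positivity)
    (by
      intro n hn
      rw [ph_second, ← hT, div_eq_mul_one_div]
      gcongr
      refine le_trans ?_ (Dlog_lower _ (by positivity))
      have : (N : ℝ) + n + 1 ≤ 2 * N := by
        have : N + n + 1 ≤ 2 * N := by omega
        exact_mod_cast this
      rw [show 4 * (N : ℝ) ^ 2 = (2 * N) ^ 2 by ring]
      gcongr)
    (by
      intro n hn
      rw [ph_second, ← hT]
      have h1 := Dlog_upper ((N : ℝ) + n) (by positivity)
      have h2 : 1 / (((N : ℝ) + n) * (N + n + 2)) ≤ 1 / ((N : ℝ) * N) := by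
        have : (0 : ℝ) ≤ n := by positivity
        gcongr <;> linarith
      calc T * Dlog ((N : ℝ) + n) ≤ T * (1 / ((N : ℝ) * N)) := by
            gcongr; linarith
        _ = 4 * (T / (4 * N ^ 2)) := by field_simp
        _ ≤ _ := by
            have : 0 < T / (4 * (N : ℝ) ^ 2) := by positivity
            linarith)
  refine key.trans ?_
  have hs : √(T / (4 * N ^ 2)) = √T / (2 * N) := by
    rw [Real.sqrt_div hT0.le, show 4 * (N : ℝ) ^ 2 = (2 * N) ^ 2 by ring,
      Real.sqrt_sq (by positivity)]
  rw [hs]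
  have s1 : √T ≤ √t := Real.sqrt_le_sqrt (by linarith)
  have s2 : √t / 3 ≤ √T := by
    apply Real.le_sqrt_of_sq_le
    rw [div_pow, Real.sq_sqrt ht.le]; linarith
  have st : 0 < √t := Real.sqrt_pos.2 ht
  have sT : 0 < √T := Real.sqrt_pos.2 hT0
  have a1 : M * (√T / (2 * N)) ≤ √t := by
    calc M * (√T / (2 * N)) ≤ N * (√t / (2 * N)) := by gcongr
      _ = √t / 2 := by field_simp
      _ ≤ √t := by linarith
  have a2 : 1 / (√T / (2 * N)) ≤ 6 * (N / √t) := by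
    calc 1 / (√T / (2 * N)) ≤ 1 / (√t / 3 / (2 * N)) := by gcongr
      _ = 6 * (N / √t) := by field_simp; norm_num
  linarith

lemma bound_D (t : ℝ) (ht : 0 < t) (N M : ℕ) (hN : t ≤ N) (hM : M ≤ N) :
    ‖∑ n ∈ Finset.range M, ee (ph t N n)‖ ≤ 28 * (N / t) := by
  have hNr : (0 : ℝ) < N := by linarith
  obtain ⟨hT1, hT2⟩ := T_bounds t ht
  rcases Nat.eq_zero_or_pos M with rfl | hM0
  · simp; positivity
  set T := t / (2 * Real.pi) with hT
  have hT0 : 0 < T := by linarith [div_pos ht (by norm_num : (0 : ℝ) < 7)]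
  have hg : ∀ n, n < M → T / (2 * N) ≤ -(ph t N (n + 1) - ph t N n) ∧
      -(ph t N (n + 1) - ph t N n) ≤ 1 / 6 := by
    intro n hn
    have hm : (0 : ℝ) < (N : ℝ) + n := by positivity
    have e : -(ph t N (n + 1) - ph t N n) = T * Real.log (((N : ℝ) + n + 1) / (N + n)) := by
      rw [Real.log_div (by positivity) (by positivity)]
      unfold ph
      push_cast
      rw [← add_assoc]
      ring
    rw [e]
    constructor
    · rw [div_eq_mul_one_div]
      gcongr
      refine le_trans ?_ (Real.one_sub_inv_le_log_of_pos (by positivity))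
      have e2 : 1 - (((N : ℝ) + n + 1) / (N + n))⁻¹ = 1 / ((N : ℝ) + n + 1) := by field_simp; ring
      rw [e2]
      have : (N : ℝ) + n + 1 ≤ 2 * N := by
        have : N + n + 1 ≤ 2 * N := by omega
        exact_mod_cast this
      gcongr
    · calc T * Real.log (((N : ℝ) + n + 1) / (N + n)) ≤ T * (((N : ℝ) + n + 1) / (N + n) - 1) := by
            gcongr
            exact Real.log_le_sub_one_of_pos (by positivity)
        _ = T * (1 / (N + n)) := by congr 1; field_simp; ring
        _ ≤ T * (1 / t) := by
            gcongr
            have : (0 : ℝ) ≤ n := by positivity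
            linarith
        _ ≤ (t / 6) * (1 / t) := by gcongr
        _ = 1 / 6 := by field_simp
  have hr : Finset.range M = Finset.Icc 0 (M - 1) := by
    ext n; simp; omega
  have hθ : T / (2 * N) ≤ 1 / 6 := (hg 0 hM0).1.trans (hg 0 hM0).2
  rw [hr]
  refine (kusmin_landau (ph t N) 0 (M - 1) (by omega) (T / (2 * N)) (by positivity) (-1)
    ?_ ?_ ?_).trans ?_
  · intro n _ hn
    have h1 := ph_second t N n
    have h2 := Dlog_lower ((N : ℝ) + n) (by positivity)
    have h3 : 0 ≤ Dlog ((N : ℝ) + n) := le_trans (by positivity) h2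
    have h4 : 0 ≤ t / (2 * Real.pi) * Dlog ((N : ℝ) + n) := by positivity
    linarith
  · intro n _ hn
    have := (hg n (by omega)).2
    push_cast
    linarith
  · intro n _ hn
    have := (hg n (by omega)).1
    push_cast
    linarith
  · calc 2 / (T / (2 * N)) ≤ 2 / (t / 7 / (2 * N)) := by gcongr
      _ = 28 * (N / t) := by field_simp; norm_num

lemma sum_inv_sqrt' (H : ℕ) : ∑ h ∈ Finset.range (H + 1), 1 / √(h : ℝ) ≤ 2 * √(H : ℝ) := by
  induction H with
  | zero => simp
  | succ H ih =>
    rw [Finset.sum_range_succ]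
    refine (add_le_add_left ih _).trans ?_
    push_cast
    have h0 : (0 : ℝ) ≤ H := by positivity
    have a := Real.sqrt_nonneg (H : ℝ)
    have b : 0 < √((H : ℝ) + 1) := Real.sqrt_pos.2 (by linarith)
    have a2 := Real.sq_sqrt h0
    have b2 := Real.sq_sqrt (by linarith : 0 ≤ (H : ℝ) + 1)
    have : 1 / √((H : ℝ) + 1) ≤ 2 * (√((H : ℝ) + 1) - √(H : ℝ)) := by
      rw [div_le_iff₀ b]
      nlinarith [sq_nonneg (√((H : ℝ) + 1) - √(H : ℝ))]
    linarith

lemma sum_inv_sqrt (H : ℕ) : ∑ h ∈ Finset.range H, 1 / √(h : ℝ) ≤ 2 * √(H : ℝ) := by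
  refine le_trans ?_ (sum_inv_sqrt' H)
  rw [Finset.sum_range_succ]
  have : 0 ≤ 1 / √(H : ℝ) := by positivity
  linarith

lemma bound_B_diff (τ : ℝ) (hτ : 1 ≤ τ) (N M h : ℕ) (hN : 1 ≤ N) (hM : M ≤ N) (h1 : 1 ≤ h)
    (hh : (h : ℝ) ≤ N / τ ^ 2) :
    ‖∑ n ∈ Finset.range (M - h), ee (ph (τ ^ 6) N n - ph (τ ^ 6) N (n + h))‖ ≤
      90 * (τ ^ 2 / 3 + 8 * (N * √(N : ℝ)) / τ ^ 3 * (1 / √(h : ℝ))) := by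
  have hNr : (1 : ℝ) ≤ N := by exact_mod_cast hN
  have hMr : (M : ℝ) ≤ N := by exact_mod_cast hM
  have hhr : (1 : ℝ) ≤ h := by exact_mod_cast h1
  have hhN : (h : ℝ) ≤ N := hh.trans (div_le_self (by positivity) (one_le_pow₀ hτ))
  obtain ⟨hT1, hT2⟩ := T_bounds (τ ^ 6) (by positivity)
  set T := τ ^ 6 / (2 * Real.pi) with hT
  have hT0 : 0 < T := by linarith [div_pos (by positivity : 0 < τ ^ 6) (by norm_num : (0 : ℝ) < 7)]
  have e : ∀ n, (ph (τ ^ 6) N (n + 2) - ph (τ ^ 6) N (n + 2 + h)) -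
      2 * (ph (τ ^ 6) N (n + 1) - ph (τ ^ 6) N (n + 1 + h)) +
      (ph (τ ^ 6) N n - ph (τ ^ 6) N (n + h)) =
      T * (Dlog ((N : ℝ) + n) - Dlog ((N : ℝ) + n + h)) := by
    intro n
    have p1 := ph_second (τ ^ 6) N n
    have p2 := ph_second (τ ^ 6) N (n + h)
    rw [show n + h + 2 = n + 2 + h by ring, show n + h + 1 = n + 1 + h by ring] at p2
    push_cast at p2
    rw [← add_assoc] at p2
    rw [← hT] at p1 p2
    linear_combination p1 - p2
  have key := second_test (fun n => ph (τ ^ 6) N n - ph (τ ^ 6) N (n + h)) (M - h)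
    (T * (h / (9 * N ^ 3))) (by positivity)
    (by
      intro n hn
      rw [e]
      gcongr
      apply Dlog_sub_lower _ _ _ (by positivity) (by positivity) _ hhN
      have : N + n + 1 ≤ 2 * N := by omega
      exact_mod_cast this)
    (by
      intro n hn
      rw [e]
      calc T * (Dlog ((N : ℝ) + n) - Dlog ((N : ℝ) + n + h)) ≤ T * (2 * h / N ^ 3) := by
            gcongr
            exact Dlog_sub_upper _ _ _ (by positivity) (by simp) (by positivity)
        _ = _ := by field_simp; norm_num)
  refine key.trans ?_
  set lam := T * (h / (9 * (N : ℝ) ^ 3)) with hlam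
  have hl0 : 0 < lam := by positivity
  have hs0 : 0 < √lam := Real.sqrt_pos.2 hl0
  have hMh : (((M - h : ℕ)) : ℝ) ≤ N := by
    have : M - h ≤ N := by omega
    exact_mod_cast this
  have u : √lam ≤ τ ^ 2 / (3 * N) := by
    rw [Real.sqrt_le_left (by positivity)]
    calc lam ≤ τ ^ 6 * ((N / τ ^ 2) / (9 * (N : ℝ) ^ 3)) := by
          rw [hlam]; gcongr
          linarith [(by positivity : 0 ≤ τ ^ 6)]
      _ = _ := by field_simp; norm_num
  have hsN := Real.sq_sqrt (by linarith : (0 : ℝ) ≤ N)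
  have hsh := Real.sq_sqrt (by linarith : (0 : ℝ) ≤ h)
  have hsN0 : 0 < √(N : ℝ) := Real.sqrt_pos.2 (by linarith)
  have hsh0 : 0 < √(h : ℝ) := Real.sqrt_pos.2 (by linarith)
  have l : τ ^ 3 * √(h : ℝ) / (8 * (N * √(N : ℝ))) ≤ √lam := by
    apply Real.le_sqrt_of_sq_le
    rw [div_pow, mul_pow, mul_pow, mul_pow, hsN, hsh]
    calc _ = τ ^ 6 / 64 * 9 * (h / (9 * (N : ℝ) ^ 3)) := by field_simp; norm_num
      _ ≤ lam := by
        rw [hlam]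
        gcongr
        linarith [(by positivity : 0 ≤ τ ^ 6)]
  have a1 : ((M - h : ℕ) : ℝ) * √lam ≤ τ ^ 2 / 3 := by
    calc ((M - h : ℕ) : ℝ) * √lam ≤ N * (τ ^ 2 / (3 * N)) := by gcongr
      _ = _ := by field_simp
  have a2 : 1 / √lam ≤ 8 * (N * √(N : ℝ)) / τ ^ 3 * (1 / √(h : ℝ)) := by
    calc 1 / √lam ≤ 1 / (τ ^ 3 * √(h : ℝ) / (8 * (N * √(N : ℝ)))) := by gcongr
      _ = _ := by field_simp
  linarith

lemma bound_B (τ : ℝ) (hτ : 1 ≤ τ) (N M : ℕ) (hN : 1 ≤ N) (hM : M ≤ N) :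
    ‖∑ n ∈ Finset.range M, ee (ph (τ ^ 6) N n)‖ ≤ 110 * (√(N : ℝ) * τ + N / τ) := by
  have hNr : (1 : ℝ) ≤ N := by exact_mod_cast hN
  have hMr : (M : ℝ) ≤ N := by exact_mod_cast hM
  have hτ0 : 0 < τ := by linarith
  have hsN := Real.sq_sqrt (by linarith : (0 : ℝ) ≤ N)
  have hsN0 : 0 < √(N : ℝ) := Real.sqrt_pos.2 (by linarith)
  set X := (N : ℝ) / τ ^ 2 with hX
  have hX0 : 0 < X := by positivity
  set H := ⌊X⌋₊ with hH
  rcases lt_or_ge X 1 with hX1 | hX1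
  · refine (norm_sum_ee_le _ _).trans ?_
    rw [Finset.card_range]
    have h1 : (N : ℝ) ≤ τ ^ 2 := by
      rw [hX, div_lt_one (by positivity)] at hX1; exact hX1.le
    have h2 : √(N : ℝ) ≤ τ := by
      rw [Real.sqrt_le_left hτ0.le]; exact h1
    have h3 : 0 < (N : ℝ) / τ := by positivity
    nlinarith
  have hH1 : 1 ≤ H := Nat.le_floor (by simpa using hX1)
  have hHr : (1 : ℝ) ≤ H := by exact_mod_cast hH1
  have hHX : (H : ℝ) ≤ X := Nat.floor_le hX0.le
  have hXH : X < H + 1 := Nat.lt_floor_add_one X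
  have hHN : (H : ℝ) ≤ N := hHX.trans (div_le_self (by positivity) (one_le_pow₀ hτ))
  set a := τ ^ 2 / 3 with ha
  set b := 8 * (N * √(N : ℝ)) / τ ^ 3 with hb
  have ha0 : 0 < a := by positivity
  have hb0 : 0 < b := by positivity
  set B : ℕ → ℝ := fun h => (if h = 0 then (N : ℝ) else 0) + 90 * (a + b * (1 / √(h : ℝ))) with hB
  have key := vdc_ee (ph (τ ^ 6) N) M H B (by
    intro h hh
    rcases Nat.eq_zero_or_pos h with rfl | hpos
    · refine (norm_sum_ee_le (fun n => ph (τ ^ 6) N n - ph (τ ^ 6) N (n + 0)) _).trans ?_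
      simp [hB]
      linarith
    · refine (bound_B_diff τ hτ N M h hN hM hpos ?_).trans ?_
      · refine le_trans ?_ hHX
        exact_mod_cast hh.le
      · simp only [hB]
        rw [if_neg (by omega), zero_add])
  have hsum : ∑ h ∈ Finset.range H, B h ≤ N + 90 * (H * a + b * (2 * √(H : ℝ))) := by
    simp only [hB]
    rw [Finset.sum_add_distrib, ← Finset.mul_sum, Finset.sum_add_distrib, ← Finset.mul_sum,
      Finset.sum_const, Finset.card_range, nsmul_eq_mul, Finset.sum_ite_eq']
    have := sum_inv_sqrt H
    rw [if_pos (Finset.mem_range.2 (by omega))]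
    gcongr
  set S := ‖∑ n ∈ Finset.range M, ee (ph (τ ^ 6) N n)‖ with hS
  have sH0 : 0 < √(H : ℝ) := Real.sqrt_pos.2 (by linarith)
  have sH := Real.sq_sqrt (by linarith : (0 : ℝ) ≤ H)
  have k2 : (H : ℝ) ^ 2 * S ^ 2 ≤ (2 * N) * (2 * H * (N + 90 * (H * a + b * (2 * √(H : ℝ))))) := by
    refine key.trans ?_
    gcongr
    linarith
  have k3 : S ^ 2 ≤ 4 * N * (N * (1 / H) + 90 * a + 180 * b * (1 / √(H : ℝ))) := by
    have e : (2 * N) * (2 * H * (N + 90 * (H * a + b * (2 * √(H : ℝ))))) =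
        (H : ℝ) ^ 2 * (4 * N * (N * (1 / H) + 90 * a + 180 * b * (1 / √(H : ℝ)))) := by
      have : 1 / √(H : ℝ) = √(H : ℝ) / H := by
        rw [div_eq_div_iff sH0.ne' (by positivity), one_mul, ← pow_two, sH]
      rw [this]
      field_simp
      ring
    rw [e] at k2
    exact le_of_mul_le_mul_left k2 (by positivity)
  have i1 : 1 / (H : ℝ) ≤ 2 * τ ^ 2 / N := by
    calc 1 / (H : ℝ) ≤ 1 / (X / 2) := by gcongr; linarith
      _ = _ := by rw [hX]; field_simp
  have i2 : 1 / √(H : ℝ) ≤ 2 * τ / √(N : ℝ) := by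
    have : √(N : ℝ) / (2 * τ) ≤ √(H : ℝ) := by
      apply Real.le_sqrt_of_sq_le
      rw [div_pow, hsN]
      have : (N : ℝ) / (2 * τ) ^ 2 = X / 4 := by rw [hX]; field_simp; norm_num
      rw [this]; linarith
    calc 1 / √(H : ℝ) ≤ 1 / (√(N : ℝ) / (2 * τ)) := by gcongr
      _ = _ := by field_simp
  have k4 : S ^ 2 ≤ 128 * (N * τ ^ 2) + 11520 * (N ^ 2 / τ ^ 2) := by
    refine k3.trans ?_
    calc _ ≤ 4 * N * (N * (2 * τ ^ 2 / N) + 90 * a + 180 * b * (2 * τ / √(N : ℝ))) := by gcongr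
      _ = _ := by
        rw [ha, hb]; field_simp; ring
  refine le_of_sq_le_sq ?_ (by positivity)
  refine k4.trans ?_
  have e1 : √(N : ℝ) * τ * (√(N : ℝ) * τ) = N * τ ^ 2 := by
    rw [← hsN]; ring_nf; rw [Real.sqrt_sq hsN0.le]
  have e2 : (N : ℝ) / τ * (N / τ) = N ^ 2 / τ ^ 2 := by field_simp
  have p1 : 0 < √(N : ℝ) * τ := by positivity
  have p2 : 0 < (N : ℝ) / τ := by positivity
  rw [← e1, ← e2]
  nlinarith [mul_pos p1 p2, mul_pos p1 p1, mul_pos p2 p2]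

lemma abel_bound (a : ℕ → ℝ) (z : ℕ → ℂ) (M : ℕ) (A : ℝ) (ha0 : ∀ n, 0 ≤ a n)
    (ha : ∀ n, a (n + 1) ≤ a n) (hz : ∀ m ≤ M, ‖∑ n ∈ Finset.range m, z n‖ ≤ A) :
    ‖∑ n ∈ Finset.range M, (a n : ℂ) * z n‖ ≤ a 0 * A := by
  have main : ∀ m ≤ M, ‖∑ n ∈ Finset.range m, (a n : ℂ) * z n - a m * ∑ n ∈ Finset.range m, z n‖ ≤
      (a 0 - a m) * A := by
    intro m
    induction m with
    | zero => simp
    | succ m ih =>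
      intro h
      have ih' := ih (by omega)
      have e : ∑ n ∈ Finset.range (m + 1), (a n : ℂ) * z n -
          a (m + 1) * ∑ n ∈ Finset.range (m + 1), z n =
          (∑ n ∈ Finset.range m, (a n : ℂ) * z n - a m * ∑ n ∈ Finset.range m, z n) +
          ((a m - a (m + 1) : ℝ) : ℂ) * ∑ n ∈ Finset.range (m + 1), z n := by
        rw [Finset.sum_range_succ, Finset.sum_range_succ]
        push_cast
        ring
      rw [e]
      refine (norm_add_le _ _).trans ?_
      rw [norm_mul, Complex.norm_real, Real.norm_of_nonneg (by linarith [ha m])]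
      have := mul_le_mul_of_nonneg_left (hz (m + 1) h) (by linarith [ha m] : 0 ≤ a m - a (m + 1))
      linarith
  have h1 := main M le_rfl
  have h2 : ‖(a M : ℂ) * ∑ n ∈ Finset.range M, z n‖ ≤ a M * A := by
    rw [norm_mul, Complex.norm_real, Real.norm_of_nonneg (ha0 M)]
    exact mul_le_mul_of_nonneg_left (hz M le_rfl) (ha0 M)
  have h3 := norm_add_le (∑ n ∈ Finset.range M, (a n : ℂ) * z n - a M * ∑ n ∈ Finset.range M, z n)
    ((a M : ℂ) * ∑ n ∈ Finset.range M, z n)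
  rw [sub_add_cancel] at h3
  linarith

lemma cpow_eq_ee (σ t : ℝ) (N n : ℕ) (hN : 1 ≤ N) :
    ((N + n : ℕ) : ℂ) ^ (-((σ : ℂ) + t * Complex.I)) =
      (((N + n : ℝ) ^ (-σ) : ℝ) : ℂ) * ee (ph t N n) := by
  have hx : (0 : ℝ) < (N : ℝ) + n := by
    have : (1 : ℝ) ≤ N := by exact_mod_cast hN
    positivity
  have hne : (((N : ℝ) + n : ℝ) : ℂ) ≠ 0 := by exact_mod_cast hx.ne'
  have e0 : ((N + n : ℕ) : ℂ) = (((N : ℝ) + n : ℝ) : ℂ) := by push_cast; rfl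
  rw [e0, neg_add, Complex.cpow_add _ _ hne, Complex.ofReal_cpow hx.le]
  congr 1
  · push_cast; rfl
  · rw [Complex.cpow_def_of_ne_zero hne, ← Complex.ofReal_log hx.le]
    unfold ee ph
    congr 1
    have : (Real.pi : ℂ) ≠ 0 := by exact_mod_cast Real.pi_ne_zero
    push_cast
    field_simp

lemma block_abel (σ t : ℝ) (hσ : 0 ≤ σ) (N : ℕ) (hN : 1 ≤ N) (A : ℝ)
    (hA : ∀ m ≤ N, ‖∑ n ∈ Finset.range m, ee (ph t N n)‖ ≤ A) :
    ‖∑ n ∈ Finset.range N, ((N + n : ℕ) : ℂ) ^ (-((σ : ℂ) + t * Complex.I))‖ ≤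
      (N : ℝ) ^ (-σ) * A := by
  have hNr : (1 : ℝ) ≤ N := by exact_mod_cast hN
  have := abel_bound (fun n => ((N : ℝ) + n) ^ (-σ)) (fun n => ee (ph t N n)) N A
    (fun n => by positivity)
    (fun n => by
      apply Real.rpow_le_rpow_of_nonpos (by positivity) (by push_cast; linarith) (by linarith)) hA
  simp only [Nat.cast_zero, add_zero] at this
  rw [Finset.sum_congr rfl (fun n _ => cpow_eq_ee σ t N n hN)]
  exact this

lemma block_bound (σ t : ℝ) (hσ : 1 / 2 ≤ σ) (ht : 2 ≤ t) (N : ℕ) (hN : 1 ≤ N)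
    (hNt : (N : ℝ) ≤ 2 * t ^ 2) :
    ‖∑ n ∈ Finset.range N, ((N + n : ℕ) : ℂ) ^ (-((σ : ℂ) + t * Complex.I))‖ ≤
      540 * (t ^ ((1 - σ) / 3) + 1) := by
  have hNr : (1 : ℝ) ≤ N := by exact_mod_cast hN
  have hN0 : (0 : ℝ) < N := by linarith
  have ht0 : 0 < t := by linarith
  have hP0 : 0 < t ^ ((1 - σ) / 3) := Real.rpow_pos_of_pos ht0 _
  have triv : ∀ m ≤ N, ‖∑ n ∈ Finset.range m, ee (ph t N n)‖ ≤ N := by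
    intro m hm
    refine (norm_sum_ee_le _ _).trans ?_
    rw [Finset.card_range]
    exact_mod_cast hm
  have eN : (N : ℝ) ^ (-σ) * N = (N : ℝ) ^ (1 - σ) := by
    rw [sub_eq_neg_add, Real.rpow_add hN0, Real.rpow_one]
  rcases le_or_gt 1 σ with hσ1 | hσ1
  · refine (block_abel σ t (by linarith) N hN N triv).trans ?_
    rw [eN]
    have := Real.rpow_le_one_of_one_le_of_nonpos hNr (by linarith : 1 - σ ≤ 0)
    linarith
  set τ := t ^ (1 / 6 : ℝ) with hτ
  have hτ1 : 1 ≤ τ := Real.one_le_rpow (by linarith) (by norm_num)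
  have hτ0 : 0 < τ := by linarith
  have hτ6 : τ ^ 6 = t := by
    rw [hτ, ← Real.rpow_natCast, ← Real.rpow_mul ht0.le]; norm_num
  have hP : t ^ ((1 - σ) / 3) = τ ^ (2 * (1 - σ)) := by
    rw [hτ, ← Real.rpow_mul ht0.le]; congr 1; ring
  rw [hP] at hP0 ⊢
  set P := τ ^ (2 * (1 - σ)) with hPd
  have r2 : τ ^ 2 = τ ^ (2 : ℝ) := by norm_cast
  have r3 : τ ^ 3 = τ ^ (3 : ℝ) := by norm_cast
  have r4 : τ ^ 4 = τ ^ (4 : ℝ) := by norm_cast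
  have r6 : τ ^ 6 = τ ^ (6 : ℝ) := by norm_cast
  have sq : √(N : ℝ) = (N : ℝ) ^ (1 / 2 : ℝ) := Real.sqrt_eq_rpow _
  rcases le_or_gt (N : ℝ) (τ ^ 2) with h2 | h2
  · refine (block_abel σ t (by linarith) N hN N triv).trans ?_
    rw [eN]
    have : (N : ℝ) ^ (1 - σ) ≤ P := by
      calc (N : ℝ) ^ (1 - σ) ≤ (τ ^ 2) ^ (1 - σ) :=
            Real.rpow_le_rpow hN0.le h2 (by linarith)
        _ = P := by rw [r2, ← Real.rpow_mul hτ0.le]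
    linarith
  rcases le_or_gt (N : ℝ) (τ ^ 4) with h4 | h4
  · have hA := fun m (hm : m ≤ N) => bound_B τ hτ1 N m hN hm
    rw [hτ6] at hA
    refine (block_abel σ t (by linarith) N hN _ hA).trans ?_
    have b1 : (N : ℝ) ^ (-σ) * (√(N : ℝ) * τ) ≤ P := by
      calc (N : ℝ) ^ (-σ) * (√(N : ℝ) * τ) = (N : ℝ) ^ (1 / 2 - σ) * τ := by
            rw [sq, ← mul_assoc, ← Real.rpow_add hN0]; congr 2; ring
        _ ≤ (τ ^ 2) ^ (1 / 2 - σ) * τ := by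
            gcongr ?_ * _
            exact Real.rpow_le_rpow_of_nonpos (by positivity) h2.le (by linarith)
        _ = (τ ^ 2) ^ (1 / 2 - σ) * τ ^ (1 : ℝ) := by rw [Real.rpow_one]
        _ = P := by
            rw [r2, ← Real.rpow_mul hτ0.le, ← Real.rpow_add hτ0]; congr 1; ring
    have b2 : (N : ℝ) ^ (-σ) * (N / τ) ≤ P := by
      calc (N : ℝ) ^ (-σ) * (N / τ) = (N : ℝ) ^ (1 - σ) / τ := by rw [← eN]; ring
        _ ≤ (τ ^ 4) ^ (1 - σ) / τ := by
            gcongr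
        _ = (τ ^ 4) ^ (1 - σ) / τ ^ (1 : ℝ) := by rw [Real.rpow_one]
        _ = τ ^ (4 * (1 - σ) - 1) := by
            rw [r4, ← Real.rpow_mul hτ0.le, ← Real.rpow_sub hτ0]
        _ ≤ P := Real.rpow_le_rpow_of_exponent_le hτ1 (by linarith)
    linarith
  rcases le_or_gt (N : ℝ) (τ ^ 6) with h6 | h6
  · have hA := fun m (hm : m ≤ N) => bound_C t ht0 N m hN hm
    refine (block_abel σ t (by linarith) N hN _ hA).trans ?_
    have st : √t = τ ^ 3 := by
      rw [← hτ6, show τ ^ 6 = (τ ^ 3) ^ 2 by ring, Real.sqrt_sq (by positivity)]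
    rw [st]
    have b1 : (N : ℝ) ^ (-σ) * τ ^ 3 ≤ P := by
      calc (N : ℝ) ^ (-σ) * τ ^ 3 ≤ (τ ^ 4) ^ (-σ) * τ ^ 3 := by
            gcongr ?_ * _
            exact Real.rpow_le_rpow_of_nonpos (by positivity) h4.le (by linarith)
        _ = τ ^ (4 * (-σ) + 3) := by
            rw [r4, r3, ← Real.rpow_mul hτ0.le, ← Real.rpow_add hτ0]
        _ ≤ P := Real.rpow_le_rpow_of_exponent_le hτ1 (by linarith)
    have b2 : (N : ℝ) ^ (-σ) * (N / τ ^ 3) ≤ 1 := by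
      calc (N : ℝ) ^ (-σ) * (N / τ ^ 3) = (N : ℝ) ^ (1 - σ) / τ ^ 3 := by rw [← eN]; ring
        _ ≤ (N : ℝ) ^ (1 / 2 : ℝ) / τ ^ 3 := by
            gcongr ?_ / _
            exact Real.rpow_le_rpow_of_exponent_le hNr (by linarith)
        _ = √(N : ℝ) / √t := by rw [sq, st]
        _ ≤ 1 := by
            rw [div_le_one (by rw [st]; positivity)]
            exact Real.sqrt_le_sqrt (by linarith)
    linarith
  · rw [hτ6] at h6
    have hA := fun m (hm : m ≤ N) => bound_D t ht0 N m h6.le hm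
    refine (block_abel σ t (by linarith) N hN _ hA).trans ?_
    have b2 : (N : ℝ) ^ (-σ) * (N / t) ≤ 2 := by
      calc (N : ℝ) ^ (-σ) * (N / t) = (N : ℝ) ^ (1 - σ) / t := by rw [← eN]; ring
        _ ≤ (N : ℝ) ^ (1 / 2 : ℝ) / t := by
            gcongr ?_ / _
            exact Real.rpow_le_rpow_of_exponent_le hNr (by linarith)
        _ = √(N : ℝ) / t := by rw [sq]
        _ ≤ 2 := by
            rw [div_le_iff₀ ht0, Real.sqrt_le_left (by positivity)]
            nlinarith
    linarith

/-- `n^{-s} - ∫_n^{n+1} x^{-s} dx`. -/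
noncomputable def zt (n : ℕ) (s : ℂ) : ℂ :=
  (n : ℂ) ^ (-s) - (((n + 1 : ℕ) : ℂ) ^ (1 - s) - (n : ℂ) ^ (1 - s)) / (1 - s)

lemma hasDerivAt_real_cpow (x : ℝ) (hx : 0 < x) (r : ℂ) :
    HasDerivAt (fun y : ℝ => (y : ℂ) ^ r) (r * (x : ℂ) ^ (r - 1)) x := by
  have h : HasDerivAt (fun z : ℂ => z ^ r) (r * (x : ℂ) ^ (r - 1) * 1) (x : ℂ) :=
    (hasDerivAt_id (x : ℂ)).cpow_const (Complex.ofReal_mem_slitPlane.2 hx)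
  rw [mul_one] at h
  exact h.comp_ofReal

lemma norm_cpow_sub (a x : ℝ) (ha : 0 < a) (hax : a ≤ x) (s : ℂ) (hs : 0 < s.re) :
    ‖(x : ℂ) ^ (-s) - (a : ℂ) ^ (-s)‖ ≤ ‖s‖ * a ^ (-s.re - 1) * (x - a) := by
  have := (convex_Icc a x).norm_image_sub_le_of_norm_hasDerivWithin_le
    (f := fun y : ℝ => (y : ℂ) ^ (-s)) (f' := fun y : ℝ => -s * (y : ℂ) ^ (-s - 1))
    (C := ‖s‖ * a ^ (-s.re - 1))
    (fun y hy => (hasDerivAt_real_cpow y (by linarith [hy.1]) (-s)).hasDerivWithinAt)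
    (fun y hy => by
      have hy0 : 0 < y := by linarith [hy.1]
      rw [norm_mul, norm_neg, Complex.norm_cpow_eq_rpow_re_of_pos hy0]
      simp only [Complex.sub_re, Complex.neg_re, Complex.one_re]
      gcongr ?_ * ?_
      exact Real.rpow_le_rpow_of_nonpos ha hy.1 (by linarith))
    (Set.left_mem_Icc.2 hax) (Set.right_mem_Icc.2 hax)
  rwa [Real.norm_of_nonneg (by linarith)] at this

lemma norm_zt_le (n : ℕ) (hn : 1 ≤ n) (s : ℂ) (hs : 0 < s.re) (hs1 : s ≠ 1) :
    ‖zt n s‖ ≤ ‖s‖ * (n : ℝ) ^ (-s.re - 1) := by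
  have hnr : (1 : ℝ) ≤ n := by exact_mod_cast hn
  have hne : 1 - s ≠ 0 := sub_ne_zero.2 hs1.symm
  have := (convex_Icc (n : ℝ) (n + 1)).norm_image_sub_le_of_norm_hasDerivWithin_le
    (f := fun y : ℝ => (y : ℂ) ^ (1 - s) / (1 - s) - (y : ℂ) * (n : ℂ) ^ (-s))
    (f' := fun y : ℝ => (y : ℂ) ^ (-s) - ((n : ℝ) : ℂ) ^ (-s))
    (C := ‖s‖ * (n : ℝ) ^ (-s.re - 1))
    (fun y hy => by
      have h1 := (hasDerivAt_real_cpow y (by linarith [hy.1]) (1 - s)).div_const (1 - s)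
      have h2 := (Complex.ofRealCLM.hasDerivAt (x := y)).mul_const ((n : ℂ) ^ (-s))
      have h3 := h1.sub h2
      refine (h3.congr_deriv ?_).hasDerivWithinAt
      rw [mul_div_cancel_left₀ _ hne]
      simp)
    (fun y hy => by
      refine (norm_cpow_sub n y (by linarith) hy.1 s hs).trans ?_
      have : 0 ≤ ‖s‖ * (n : ℝ) ^ (-s.re - 1) := by positivity
      nlinarith [hy.2])
    (Set.left_mem_Icc.2 (by linarith)) (Set.right_mem_Icc.2 (by linarith))
  have e : zt n s = -(((((n : ℝ) + 1 : ℝ) : ℂ) ^ (1 - s) / (1 - s) - (((n : ℝ) + 1 : ℝ) : ℂ) * (n : ℂ) ^ (-s)) -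
      (((n : ℝ) : ℂ) ^ (1 - s) / (1 - s) - ((n : ℝ) : ℂ) * (n : ℂ) ^ (-s))) := by
    unfold zt
    push_cast
    ring
  rw [e, norm_neg]
  refine this.trans (le_of_eq ?_)
  simp

lemma sum_zt (s : ℂ) (K : ℕ) : ∑ k ∈ Finset.range K, zt (k + 1) s =
    ∑ k ∈ Finset.range K, ((k + 1 : ℕ) : ℂ) ^ (-s) - (((K + 1 : ℕ) : ℂ) ^ (1 - s) - 1) / (1 - s) := by
  induction K with
  | zero => simp
  | succ K ih =>
    rw [Finset.sum_range_succ, Finset.sum_range_succ, ih]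
    unfold zt
    ring

lemma hasSum_zt_of_one_lt (s : ℂ) (hs : 1 < s.re) (hsum : Summable (fun k => zt (k + 1) s)) :
    ∑' k, zt (k + 1) s = riemannZeta s - 1 / (s - 1) := by
  have h1 := hsum.hasSum.tendsto_sum_nat
  have hz : HasSum (fun k : ℕ => ((k + 1 : ℕ) : ℂ) ^ (-s)) (riemannZeta s) := by
    rw [zeta_eq_tsum_one_div_nat_add_one_cpow hs]
    have hS : Summable (fun k : ℕ => 1 / ((k : ℂ) + 1) ^ s) := by
      have := (summable_nat_add_iff 1).2 (Complex.summable_one_div_nat_cpow.2 hs)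
      simpa using this
    have e : (fun k : ℕ => ((k + 1 : ℕ) : ℂ) ^ (-s)) = fun k : ℕ => 1 / ((k : ℂ) + 1) ^ s := by
      funext k
      rw [Complex.cpow_neg]
      simp
    rw [e]
    exact hS.hasSum
  have h2 := hz.tendsto_sum_nat
  have h3 : Filter.Tendsto (fun K : ℕ => ((K + 1 : ℕ) : ℂ) ^ (1 - s)) Filter.atTop (nhds 0) := by
    rw [tendsto_zero_iff_norm_tendsto_zero]
    have e : (fun K : ℕ => ‖((K + 1 : ℕ) : ℂ) ^ (1 - s)‖) =
        fun K : ℕ => ((K + 1 : ℕ) : ℝ) ^ (-(s.re - 1)) := by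
      funext K
      rw [Complex.norm_natCast_cpow_of_pos (by omega)]
      simp
    rw [e]
    exact ((tendsto_rpow_neg_atTop (by linarith : 0 < s.re - 1)).comp
      tendsto_natCast_atTop_atTop).comp (Filter.tendsto_add_atTop_nat 1)
  have h4 := h2.sub ((h3.sub_const 1).div_const (1 - s))
  simp only [← sum_zt] at h4
  rw [tendsto_nhds_unique h1 h4]
  rw [show s - 1 = -(1 - s) by ring, div_neg]
  ring

lemma zeta_zt (s : ℂ) (hs : 1 / 4 < s.re) (hi : 0 < s.im) :
    HasSum (fun k => zt (k + 1) s) (riemannZeta s - 1 / (s - 1)) := by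
  set R := ‖s‖ + 10 with hR
  set U : Set ℂ := {z | 1 / 4 < z.re} ∩ {z | 0 < z.im} ∩ Metric.ball 0 R with hU
  have hUo : IsOpen U := ((isOpen_lt continuous_const Complex.continuous_re).inter
    (isOpen_lt continuous_const Complex.continuous_im)).inter Metric.isOpen_ball
  have hUc : Convex ℝ U := ((convex_halfSpace_re_gt _).inter (convex_halfSpace_im_gt _)).inter
    (convex_ball _ _)
  have hne : ∀ z ∈ U, z ≠ 1 := by
    rintro z hz rfl
    have := hz.1.2
    simp at this
  have hu : Summable (fun k : ℕ => R * ((k + 1 : ℕ) : ℝ) ^ (-(5 / 4) : ℝ)) := by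
    apply Summable.mul_left
    have := (summable_nat_add_iff 1).2 (Real.summable_nat_rpow.2 (by norm_num : (-(5 / 4) : ℝ) < -1))
    exact this
  have hle : ∀ (k : ℕ) (z : ℂ), z ∈ U → ‖zt (k + 1) z‖ ≤ R * ((k + 1 : ℕ) : ℝ) ^ (-(5 / 4) : ℝ) := by
    intro k z hz
    have hre : 1 / 4 < z.re := hz.1.1
    refine (norm_zt_le (k + 1) (by omega) z (by linarith) (hne z hz)).trans ?_
    have h1 : ‖z‖ ≤ R := by
      have := hz.2
      rw [mem_ball_zero_iff] at this
      exact this.le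
    have h2 : (1 : ℝ) ≤ ((k + 1 : ℕ) : ℝ) := by exact_mod_cast (by omega : 1 ≤ k + 1)
    have h3 := Real.rpow_le_rpow_of_exponent_le h2 (by linarith : -z.re - 1 ≤ -(5 / 4))
    gcongr
  have hsum : ∀ z ∈ U, Summable (fun k => zt (k + 1) z) := fun z hz =>
    Summable.of_norm_bounded hu (fun k => hle k z hz)
  have hdiff : DifferentiableOn ℂ (fun z => ∑' k, zt (k + 1) z) U := by
    apply Complex.differentiableOn_tsum_of_summable_norm hu _ hUo hle
    intro k z hz
    have hk : ((k + 1 : ℕ) : ℂ) ≠ 0 := by exact_mod_cast (by omega : k + 1 ≠ 0)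
    have hk2 : ((k + 1 + 1 : ℕ) : ℂ) ≠ 0 := by exact_mod_cast (by omega : k + 1 + 1 ≠ 0)
    have h1 : 1 - z ≠ 0 := sub_ne_zero.2 (hne z hz).symm
    apply DifferentiableAt.differentiableWithinAt
    unfold zt
    have d1 : DifferentiableAt ℂ (fun z : ℂ => ((k + 1 : ℕ) : ℂ) ^ (-z)) z :=
      differentiableAt_id.neg.const_cpow (Or.inl hk)
    have d2 : DifferentiableAt ℂ (fun z : ℂ => ((k + 1 : ℕ) : ℂ) ^ (1 - z)) z :=
      (differentiableAt_id.const_sub 1).const_cpow (Or.inl hk)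
    have d3 : DifferentiableAt ℂ (fun z : ℂ => ((k + 1 + 1 : ℕ) : ℂ) ^ (1 - z)) z :=
      (differentiableAt_id.const_sub 1).const_cpow (Or.inl hk2)
    exact d1.sub ((d3.sub d2).div (differentiableAt_id.const_sub 1) h1)
  have hdiff2 : DifferentiableOn ℂ (fun z => riemannZeta z - 1 / (z - 1)) U := by
    intro z hz
    apply DifferentiableAt.differentiableWithinAt
    exact (differentiableAt_riemannZeta (hne z hz)).sub
      ((differentiableAt_const 1).div (differentiableAt_id.sub_const 1) (sub_ne_zero.2 (hne z hz)))
  have hz0 : (2 + Complex.I : ℂ) ∈ U := by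
    refine ⟨⟨?_, ?_⟩, ?_⟩
    · show (1 / 4 : ℝ) < (2 + Complex.I).re
      simp; norm_num
    · show (0 : ℝ) < (2 + Complex.I).im
      simp
    · rw [mem_ball_zero_iff]
      refine (norm_add_le _ _).trans_lt ?_
      simp only [RCLike.norm_ofNat, Complex.norm_I]
      have := norm_nonneg s
      rw [hR]; linarith
  have hEq := (hdiff.analyticOnNhd hUo).eqOn_of_preconnected_of_eventuallyEq
    (hdiff2.analyticOnNhd hUo) hUc.isPreconnected hz0 (by
      have ho : {z : ℂ | 1 < z.re} ∈ nhds (2 + Complex.I : ℂ) :=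
        (isOpen_lt continuous_const Complex.continuous_re).mem_nhds (by
          show (1 : ℝ) < (2 + Complex.I).re
          simp)
      filter_upwards [ho, hUo.mem_nhds hz0] with z hz1 hz2
      exact hasSum_zt_of_one_lt z hz1 (hsum z hz2))
  have hsU : s ∈ U := by
    refine ⟨⟨hs, hi⟩, ?_⟩
    rw [mem_ball_zero_iff, hR]
    linarith
  have := hEq hsU
  simp only at this
  rw [← this]
  exact (hsum s hsU).hasSum

lemma tail_step (x : ℝ) (hx : 1 ≤ x) : x ^ (-(3 / 2) : ℝ) ≤ 4 / √x - 4 / √(x + 1) := by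
  have hx0 : 0 < x := by linarith
  have e : x ^ (-(3 / 2) : ℝ) = 1 / √x ^ 3 := by
    rw [Real.rpow_neg hx0.le, Real.sqrt_eq_rpow, ← Real.rpow_natCast, ← Real.rpow_mul hx0.le]
    norm_num
  rw [e]
  have hp : 1 ≤ √x := Real.one_le_sqrt.2 hx
  have hp2 := Real.sq_sqrt hx0.le
  have hq2 := Real.sq_sqrt (by linarith : 0 ≤ x + 1)
  have hq : 0 < √(x + 1) := Real.sqrt_pos.2 (by linarith)
  generalize √x = p at *
  generalize √(x + 1) = q at *
  have hp0 : 0 < p := by linarith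
  have hqp : q ≤ 3 / 2 * p := by nlinarith
  have hd : (q - p) * (q + p) = 1 := by nlinarith
  have hpq : p < q := by nlinarith
  have e2 : 4 / p - 4 / q = 4 * (q - p) / (p * q) := by field_simp
  rw [e2, div_le_div_iff₀ (by positivity) (by positivity)]
  have h1 : 1 ≤ (q - p) * (5 / 2 * p) := by
    rw [← hd]
    exact mul_le_mul_of_nonneg_left (by linarith) (by linarith)
  have h2 : p * q ≤ p * (3 / 2 * p) := by gcongr
  have h3 : p ^ 2 * 1 ≤ p ^ 2 * ((q - p) * (5 / 2 * p)) := by gcongr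
  nlinarith

lemma tail_bound (s : ℂ) (hs : 1 / 2 ≤ s.re) (hi : 0 < s.im) (K : ℕ) :
    ‖riemannZeta s - 1 / (s - 1) - ∑ k ∈ Finset.range K, zt (k + 1) s‖ ≤
      ‖s‖ * (4 / √((K : ℝ) + 1)) := by
  have hne : s ≠ 1 := by
    rintro rfl
    simp at hi
  have h := zeta_zt s (by linarith) hi
  have h1 := ((hasSum_nat_add_iff' K).2 h).tendsto_sum_nat
  refine le_of_tendsto h1.norm (Filter.Eventually.of_forall fun n => ?_)
  have hb : ∀ m : ℕ, ‖s‖ * ∑ k ∈ Finset.range m, ((k + K + 1 : ℕ) : ℝ) ^ (-(3 / 2) : ℝ) ≤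
      ‖s‖ * (4 / √((K : ℝ) + 1) - 4 / √((m : ℝ) + K + 1)) := by
    intro m
    gcongr
    induction m with
    | zero => simp
    | succ m ih =>
      rw [Finset.sum_range_succ]
      have := tail_step ((m + K + 1 : ℕ) : ℝ) (by exact_mod_cast (by omega : 1 ≤ m + K + 1))
      push_cast at this ⊢
      rw [show (m : ℝ) + 1 + K + 1 = m + K + 1 + 1 by ring]
      push_cast at ih
      linarith
  refine (norm_sum_le _ _).trans ?_
  calc _ ≤ ∑ k ∈ Finset.range n, ‖s‖ * ((k + K + 1 : ℕ) : ℝ) ^ (-(3 / 2) : ℝ) := by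
        apply Finset.sum_le_sum
        intro k _
        refine (norm_zt_le (k + K + 1) (by omega) s (by linarith) hne).trans ?_
        gcongr ?_ * ?_
        apply Real.rpow_le_rpow_of_exponent_le
        · exact_mod_cast (by omega : 1 ≤ k + K + 1)
        · linarith
    _ = ‖s‖ * ∑ k ∈ Finset.range n, ((k + K + 1 : ℕ) : ℝ) ^ (-(3 / 2) : ℝ) := by
        rw [Finset.mul_sum]
    _ ≤ _ := by
        refine (hb n).trans ?_
        gcongr
        have : 0 ≤ 4 / √((n : ℝ) + K + 1) := by positivity
        linarith

lemma dyadic (F : ℕ → ℂ) (J : ℕ) : ∑ k ∈ Finset.range (2 ^ J - 1), F (k + 1) =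
    ∑ j ∈ Finset.range J, ∑ n ∈ Finset.range (2 ^ j), F (2 ^ j + n) := by
  induction J with
  | zero => simp
  | succ J ih =>
    have hp : 0 < 2 ^ J := by positivity
    rw [Finset.sum_range_succ, ← ih, show 2 ^ (J + 1) - 1 = (2 ^ J - 1) + 2 ^ J by
      rw [pow_succ]; omega, Finset.sum_range_add]
    congr 1
    apply Finset.sum_congr rfl
    intro n _
    congr 1
    omega

lemma zeta_small_sigma (σ t : ℝ) (hσ : 1 / 2 ≤ σ) (hσ2 : σ ≤ 2) (ht : 2 ≤ t) :
    ‖riemannZeta (σ + t * Complex.I)‖ ≤ 3000 * (t ^ ((1 - σ) / 3) + 1) * Real.log t := by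
  have ht0 : 0 < t := by linarith
  set s : ℂ := σ + t * Complex.I with hs
  have hre : s.re = σ := by simp [hs]
  have him : s.im = t := by simp [hs]
  obtain ⟨n, hn1, hn2⟩ := exists_nat_pow_near (by nlinarith : (1 : ℝ) ≤ t ^ 2)
    (by norm_num : (1 : ℝ) < 2)
  set J := n + 1 with hJ
  have hJ2 : (2 : ℝ) ^ J ≤ 2 * t ^ 2 := by rw [hJ, pow_succ]; linarith
  have hcast : (((2 ^ J - 1 : ℕ) : ℝ)) + 1 = 2 ^ J := by
    have : 1 ≤ 2 ^ J := Nat.one_le_two_pow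
    push_cast [Nat.cast_sub this]
    ring
  have hnat : 2 ^ J - 1 + 1 = 2 ^ J := Nat.sub_add_cancel Nat.one_le_two_pow
  have htail := tail_bound s (by rw [hre]; exact hσ) (by rw [him]; exact ht0) (2 ^ J - 1)
  rw [sum_zt, hcast, hnat, dyadic (fun m => (m : ℂ) ^ (-s))] at htail
  set D := ∑ j ∈ Finset.range J, ∑ n ∈ Finset.range (2 ^ j), ((2 ^ j + n : ℕ) : ℂ) ^ (-s) with hD
  set E := ((2 ^ J : ℕ) : ℂ) ^ (1 - s) / (1 - s) with hE
  have e : riemannZeta s = (riemannZeta s - 1 / (s - 1) -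
      (D - (((2 ^ J : ℕ) : ℂ) ^ (1 - s) - 1) / (1 - s))) + D - E := by
    rw [hE, show s - 1 = -(1 - s) by ring, div_neg, sub_div]
    ring
  set P := t ^ ((1 - σ) / 3) with hP
  have hP0 : 0 < P := Real.rpow_pos_of_pos ht0 _
  have hDb : ‖D‖ ≤ J * (540 * (P + 1)) := by
    rw [hD]
    refine (norm_sum_le_of_le (f := fun j => ∑ n ∈ Finset.range (2 ^ j), ((2 ^ j + n : ℕ) : ℂ) ^ (-s))
      (Finset.range J) (n := fun _ => 540 * (P + 1)) ?_).trans ?_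
    · intro j hj
      rw [Finset.mem_range] at hj
      apply block_bound σ t hσ ht (2 ^ j) Nat.one_le_two_pow
      refine le_trans ?_ hJ2
      push_cast
      exact pow_le_pow_right₀ (by norm_num) hj.le
    · simp
  have hpow : (1 : ℝ) ≤ 2 ^ J := one_le_pow₀ (by norm_num)
  have hEb : ‖E‖ ≤ 2 := by
    rw [hE, norm_div, Complex.norm_natCast_cpow_of_pos (by positivity)]
    have h1 : t ≤ ‖1 - s‖ := by
      have := Complex.abs_im_le_norm (1 - s)
      rw [Complex.sub_im, him, Complex.one_im, zero_sub, abs_neg, abs_of_pos ht0] at this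
      exact this
    rw [Complex.sub_re, hre, Complex.one_re]
    push_cast
    have h2 : ((2 : ℝ) ^ J) ^ (1 - σ) ≤ 2 * t := by
      calc ((2 : ℝ) ^ J) ^ (1 - σ) ≤ ((2 : ℝ) ^ J) ^ (1 / 2 : ℝ) :=
            Real.rpow_le_rpow_of_exponent_le hpow (by linarith)
        _ = √((2 : ℝ) ^ J) := (Real.sqrt_eq_rpow _).symm
        _ ≤ 2 * t := by
            rw [Real.sqrt_le_left (by positivity)]
            nlinarith
    rw [div_le_iff₀ (by linarith)]
    linarith
  have hTb : ‖s‖ * (4 / √((2 : ℝ) ^ J)) ≤ 8 := by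
    have h1 : ‖s‖ ≤ 2 * t := by
      rw [hs]
      refine (norm_add_le _ _).trans ?_
      rw [norm_mul, Complex.norm_I, Complex.norm_real, Complex.norm_real,
        Real.norm_of_nonneg (by linarith), Real.norm_of_nonneg (by linarith)]
      linarith
    have h2 : t ≤ √((2 : ℝ) ^ J) := Real.le_sqrt_of_sq_le hn2.le
    calc ‖s‖ * (4 / √((2 : ℝ) ^ J)) ≤ (2 * t) * (4 / t) := by gcongr
      _ = 8 := by field_simp; norm_num
  have hlog2 := Real.log_two_gt_d9
  have hlogt : Real.log 2 ≤ Real.log t := Real.log_le_log (by norm_num) ht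
  have hJl : (J : ℝ) ≤ 5 * Real.log t := by
    have := Real.log_le_log (by positivity) hn1
    rw [Real.log_pow, Real.log_pow] at this
    have hn0 : (0 : ℝ) ≤ n := by positivity
    rw [hJ]
    push_cast at this ⊢
    nlinarith
  have htot : ‖riemannZeta s‖ ≤ 8 + J * (540 * (P + 1)) + 2 := by
    rw [e]
    refine (norm_sub_le _ _).trans ?_
    refine add_le_add ((norm_add_le _ _).trans (add_le_add (htail.trans hTb) hDb)) hEb
  have h5 : (J : ℝ) * (540 * (P + 1)) ≤ 5 * Real.log t * (540 * (P + 1)) := by gcongr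
  have h6 : 0 ≤ P * Real.log t := by
    have : 0 ≤ Real.log t := by linarith
    positivity
  nlinarith

lemma zeta_large_sigma : ∃ Z : ℝ, 0 ≤ Z ∧ ∀ s : ℂ, 2 ≤ s.re → ‖riemannZeta s‖ ≤ Z := by
  have hsum : Summable (fun n : ℕ => 1 / ((n : ℝ) + 1) ^ 2) := by
    have := (summable_nat_add_iff 1).2 (Real.summable_one_div_nat_pow.2 (by norm_num : 1 < 2))
    simpa using this
  refine ⟨∑' n : ℕ, 1 / ((n : ℝ) + 1) ^ 2, tsum_nonneg (fun n => by positivity), ?_⟩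
  intro s hs
  rw [zeta_eq_tsum_one_div_nat_add_one_cpow (by linarith)]
  apply tsum_of_norm_bounded hsum.hasSum
  intro n
  rw [norm_div, norm_one, show (n : ℂ) + 1 = ((n + 1 : ℕ) : ℂ) by push_cast; rfl,
    Complex.norm_natCast_cpow_of_pos (by omega)]
  have h1 : (1 : ℝ) ≤ ((n + 1 : ℕ) : ℝ) := by exact_mod_cast (by omega : 1 ≤ n + 1)
  have h2 := Real.rpow_le_rpow_of_exponent_le h1 hs
  rw [Real.rpow_two] at h2
  push_cast at h2 ⊢
  gcongr

/-- Convexity bound: for `σ ≥ 1/2` and `t ≥ 2`,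
`|ζ(σ+it)| ≪ (t^{(1−σ)/3} + 1) log t` with an absolute implied constant. -/
theorem zeta_convexity_bound :
    ∃ C > 0, ∀ σ t : ℝ, 1 / 2 ≤ σ → 2 ≤ t →
      ‖riemannZeta (σ + t * Complex.I)‖ ≤ C * (t ^ ((1 - σ) / 3) + 1) * Real.log t := by
  obtain ⟨Z, hZ0, hZ⟩ := zeta_large_sigma
  refine ⟨3000 + 2 * Z, by positivity, ?_⟩
  intro σ t hσ ht
  have hP0 : 0 < t ^ ((1 - σ) / 3) := Real.rpow_pos_of_pos (by linarith) _
  have hlog2 := Real.log_two_gt_d9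
  have hlogt : Real.log 2 ≤ Real.log t := Real.log_le_log (by norm_num) ht
  have hl : 0 < Real.log t := by linarith
  have h6 : 0 < (t ^ ((1 - σ) / 3) + 1) * Real.log t := by positivity
  have h7 : Real.log t ≤ (t ^ ((1 - σ) / 3) + 1) * Real.log t := by nlinarith
  rcases le_total σ 2 with h | h
  · refine (zeta_small_sigma σ t hσ h ht).trans ?_
    nlinarith
  · refine (hZ _ (by simpa using h)).trans ?_
    nlinarith
end
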